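/- Let R be a two-sided noetherian ring. If the class GI of Gorenstein injective left R-modules is closed under direct limits, then GI is a covering class: every left R-module has a Gorenstein injective cover. -/

import Mathlib

open CategoryTheory CategoryTheory.Limits

universe u

section GenericDefs

variable {𝒜 : Type*} [Category 𝒜] [Abelian 𝒜]

/-- An object `G` of an abelian category is *Gorenstein injective* if it is a cycle object of
an exact (ℤ-indexed) complex of injective objects which stays exact under `Hom(I, -)` for
every injective object `I`. -/
def IsGorensteinInjective (G : 𝒜) : Prop :=
  ∃ C : ChainComplex 𝒜 ℤ,
    (∀ n, Injective (C.X n)) ∧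
    (∀ n, C.ExactAt n) ∧
    (∀ (I : 𝒜), Injective I → ∀ n,
      (((preadditiveCoyoneda.obj (Opposite.op I)).mapHomologicalComplex _).obj C).ExactAt n) ∧
    Nonempty (G ≅ kernel (C.d 0 (-1)))

/-- An object `G` is *Gorenstein projective* if it is a cycle object of an exact complex of
projectives which stays exact under `Hom(-, P)` for every projective `P`. -/
def IsGorensteinProjective (G : 𝒜) : Prop :=
  ∃ C : ChainComplex 𝒜 ℤ,
    (∀ n, Projective (C.X n)) ∧
    (∀ n, C.ExactAt n) ∧
    (∀ (P : 𝒜), Projective P → ∀ n,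
      (((preadditiveYoneda.obj P).mapHomologicalComplex _).obj C.op).ExactAt n) ∧
    Nonempty (G ≅ kernel (C.d 0 (-1)))

/-- `φ : G ⟶ X` is a `𝒞`-precover of `X`. -/
def IsPrecover (𝒞 : 𝒜 → Prop) {G X : 𝒜} (φ : G ⟶ X) : Prop :=
  𝒞 G ∧ ∀ (G' : 𝒜), 𝒞 G' → ∀ ψ : G' ⟶ X, ∃ h : G' ⟶ G, h ≫ φ = ψ

/-- `φ : G ⟶ X` is a `𝒞`-cover of `X`. -/
def IsCover (𝒞 : 𝒜 → Prop) {G X : 𝒜} (φ : G ⟶ X) : Prop :=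
  IsPrecover 𝒞 φ ∧ ∀ f : G ⟶ G, f ≫ φ = φ → IsIso f

/-- `φ : X ⟶ G` is a `𝒞`-preenvelope of `X`. -/
def IsPreenvelope (𝒞 : 𝒜 → Prop) {X G : 𝒜} (φ : X ⟶ G) : Prop :=
  𝒞 G ∧ ∀ (G' : 𝒜), 𝒞 G' → ∀ ψ : X ⟶ G', ∃ h : G ⟶ G', φ ≫ h = ψ

/-- `φ : X ⟶ G` is a `𝒞`-envelope of `X`. -/
def IsEnvelope (𝒞 : 𝒜 → Prop) {X G : 𝒜} (φ : X ⟶ G) : Prop :=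
  IsPreenvelope 𝒞 φ ∧ ∀ f : G ⟶ G, φ ≫ f = φ → IsIso f

/-- `Ext¹(X, Y) = 0`, expressed by the splitting of every extension of `X` by `Y`. -/
def Ext1Zero (X Y : 𝒜) : Prop :=
  ∀ (E : 𝒜) (i : Y ⟶ E) (p : E ⟶ X) (w : i ≫ p = 0),
    (ShortComplex.mk i p w).ShortExact → ∃ s : X ⟶ E, s ≫ p = 𝟙 X

/-- `ExtSucZero n X Y` says `Ext^(n+1)(X, Y) = 0`; defined by dimension shifting along
short exact sequences `0 ⟶ Y ⟶ E ⟶ Y' ⟶ 0` with `E` injective. -/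
def ExtSucZero : ℕ → 𝒜 → 𝒜 → Prop
  | 0, X, Y => Ext1Zero X Y
  | (n+1), X, Y => ∀ (E Y' : 𝒜) (i : Y ⟶ E) (p : E ⟶ Y') (w : i ≫ p = 0),
      (ShortComplex.mk i p w).ShortExact → Injective E → ExtSucZero n X Y'

/-- A special `𝒞`-precover: an epimorphism `φ : G ⟶ X` with `G ∈ 𝒞` arising in a short exact
sequence `0 ⟶ A ⟶ G ⟶ X ⟶ 0` with `Ext¹(G', A) = 0` for all `G' ∈ 𝒞`. -/
def IsSpecialPrecover (𝒞 : 𝒜 → Prop) {G X : 𝒜} (φ : G ⟶ X) : Prop :=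
  IsPrecover 𝒞 φ ∧ ∃ (A : 𝒜) (i : A ⟶ G) (w : i ≫ φ = 0),
    (ShortComplex.mk i φ w).ShortExact ∧ ∀ (G' : 𝒜), 𝒞 G' → Ext1Zero G' A

/-- The left `Ext¹`-orthogonal class `⊥𝒞` of a class of objects `𝒞`. -/
def leftOrthogonal {𝒜 : Type*} [Category 𝒜] [Abelian 𝒜] (𝒞 : 𝒜 → Prop) (X : 𝒜) : Prop :=
  ∀ Y : 𝒜, 𝒞 Y → Ext1Zero X Y

/-- The right `Ext¹`-orthogonal class `𝒞⊥` of a class of objects `𝒞`. -/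
def rightOrthogonal {𝒜 : Type*} [Category 𝒜] [Abelian 𝒜] (𝒞 : 𝒜 → Prop) (Y : 𝒜) : Prop :=
  ∀ X : 𝒜, 𝒞 X → Ext1Zero X Y

end GenericDefs

section Baer

variable {R : Type u} [Ring R]
variable {A B C : Type u} [AddCommGroup A] [Module R A] [AddCommGroup B] [Module R B]
  [AddCommGroup C] [Module R C]

theorem LinearMap.exists_comp_eq_of_ker_le {p : A →ₗ[R] B} (hp : Function.Surjective p)
    {q : A →ₗ[R] C} (h : ∀ x, p x = 0 → q x = 0) : ∃ g : B →ₗ[R] C, ∀ x, g (p x) = q x := by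
  have h' : LinearMap.ker p ≤ LinearMap.ker q := fun x hx => h x hx
  refine ⟨((LinearMap.ker p).liftQ q h') ∘ₗ (p.quotKerEquivOfSurjective hp).symm.toLinearMap,
    fun x => ?_⟩
  have : (p.quotKerEquivOfSurjective hp).symm (p x) = Submodule.Quotient.mk x := by
    rw [LinearEquiv.symm_apply_eq]; simp
  simp [this]

theorem Module.Baer.of_retract (hB : Module.Baer R B) (i : A →ₗ[R] B) (r : B →ₗ[R] A)
    (h : ∀ x, r (i x) = x) : Module.Baer R A := fun I g => by
  obtain ⟨g', hg'⟩ := hB I (i ∘ₗ g)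
  exact ⟨r ∘ₗ g', fun x hx => by simp [hg' x hx, h]⟩

theorem Module.Baer.prod (hA : Module.Baer R A) (hB : Module.Baer R B) :
    Module.Baer R (A × B) := fun I g => by
  obtain ⟨a, ha⟩ := hA I (LinearMap.fst R A B ∘ₗ g)
  obtain ⟨b, hb⟩ := hB I (LinearMap.snd R A B ∘ₗ g)
  exact ⟨a.prod b, fun x hx => Prod.ext (ha x hx) (hb x hx)⟩

theorem Module.Baer.pi {ι : Type*} {M : ι → Type*} [∀ i, AddCommGroup (M i)]
    [∀ i, Module R (M i)] (h : ∀ i, Module.Baer R (M i)) : Module.Baer R (∀ i, M i) :=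
  fun I g => by
  choose k hk using fun i => h i I (LinearMap.proj i ∘ₗ g)
  exact ⟨LinearMap.pi k, fun x hx => funext fun i => hk i x hx⟩

theorem Module.Baer.exists_section (hA : Module.Baer R A) {i : A →ₗ[R] B} {p : B →ₗ[R] C}
    (hi : Function.Injective i) (hp : Function.Surjective p) (hip : Function.Exact i p) :
    ∃ (r : B →ₗ[R] A) (s : C →ₗ[R] B), (∀ a, r (i a) = a) ∧ (∀ c, p (s c) = c) ∧
      ∀ b, i (r b) + s (p b) = b := by
  obtain ⟨r, hr⟩ := hA.extension_property i hi LinearMap.id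
  have hr' : ∀ a, r (i a) = a := fun a => LinearMap.congr_fun hr a
  obtain ⟨s, hs⟩ := LinearMap.exists_comp_eq_of_ker_le hp
    (q := LinearMap.id - i ∘ₗ r) (fun x hx => by
      obtain ⟨a, rfl⟩ := (hip x).1 hx
      simp [hr'])
  refine ⟨r, s, hr', fun c => ?_, fun b => ?_⟩
  · obtain ⟨b, rfl⟩ := hp c
    rw [hs]
    simp [(hip (i (r b))).2 ⟨_, rfl⟩]
  · rw [hs]; simp

theorem Module.Baer.of_exact (hA : Module.Baer R A) {i : A →ₗ[R] B} {p : B →ₗ[R] C}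
    (hi : Function.Injective i) (hp : Function.Surjective p) (hip : Function.Exact i p)
    (hC : Module.Baer R C) : Module.Baer R B := by
  obtain ⟨r, s, -, -, h⟩ := hA.exists_section hi hp hip
  exact (hA.prod hC).of_retract (r.prod p) (i.coprod s) (by simpa using h)

theorem Module.Baer.of_exact_right (hA : Module.Baer R A) {i : A →ₗ[R] B} {p : B →ₗ[R] C}
    (hi : Function.Injective i) (hp : Function.Surjective p) (hip : Function.Exact i p)
    (hB : Module.Baer R B) : Module.Baer R C := by
  obtain ⟨r, s, -, hs, -⟩ := hA.exists_section hi hp hip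
  exact hB.of_retract s p hs

theorem Submodule.baer_sSup [IsNoetherianRing R] {𝒮 : Set (Submodule R A)} (hne : 𝒮.Nonempty)
    (hdir : DirectedOn (· ≤ ·) 𝒮) (h : ∀ D ∈ 𝒮, Module.Baer R D) :
    Module.Baer R (sSup 𝒮 : Submodule R A) := fun I g => by
  obtain ⟨s, hs⟩ := (isNoetherianRing_iff_ideal_fg R).1 ‹_› I
  have key : ∀ t : Finset R, ∃ D ∈ 𝒮, ∀ x (hx : x ∈ I), x ∈ t → (g ⟨x, hx⟩ : A) ∈ D := by
    classical
    intro t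
    induction t using Finset.induction_on with
    | empty => obtain ⟨D, hD⟩ := hne; exact ⟨D, hD, by simp⟩
    | insert a t _ ih =>
      obtain ⟨D, hD, h₁⟩ := ih
      by_cases ha : a ∈ I
      · obtain ⟨D', hD', h₂⟩ := (Submodule.mem_sSup_of_directed hne hdir).1 (g ⟨a, ha⟩).2
        obtain ⟨D'', hD'', l₁, l₂⟩ := hdir D hD D' hD'
        refine ⟨D'', hD'', fun x hx hxt => ?_⟩
        rcases Finset.mem_insert.1 hxt with rfl | hxt
        · exact l₂ h₂
        · exact l₁ (h₁ x hx hxt)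
      · refine ⟨D, hD, fun x hx hxt => ?_⟩
        rcases Finset.mem_insert.1 hxt with rfl | hxt
        · exact absurd hx ha
        · exact h₁ x hx hxt
  obtain ⟨D, hD, hsD⟩ := key s
  have hgD : ∀ x : I, (g x : A) ∈ D := by
    have : I ≤ (D.comap ((sSup 𝒮).subtype ∘ₗ g)).map I.subtype := by
      refine hs.symm.le.trans (Submodule.span_le.2 ?_)
      intro x hx
      have hxI : x ∈ I := hs ▸ Ideal.subset_span hx
      exact ⟨⟨x, hxI⟩, hsD x hxI hx, rfl⟩
    rintro ⟨x, hx⟩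
    obtain ⟨y, hy, rfl⟩ := this hx
    exact hy
  obtain ⟨g', hg'⟩ := h D hD I (((sSup 𝒮).subtype ∘ₗ g).codRestrict D hgD)
  refine ⟨Submodule.inclusion (le_sSup hD) ∘ₗ g', fun x hx => Subtype.ext ?_⟩
  have := congrArg Subtype.val (hg' x hx)
  exact this

end Baer

/-- A differential module `(M, d)` is *totally acyclic* if `M` is injective, `ker d = im d`, and
`Hom(I, M)` is acyclic for every injective module `I`. -/
structure TotallyAcyclic {R : Type u} [Ring R] {M : Type u} [AddCommGroup M] [Module R M]
    (d : M →ₗ[R] M) : Prop where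
  baer : Module.Baer R M
  exact : ∀ x, d x = 0 ↔ ∃ y, d y = x
  lift : ∀ (I : Type u) [AddCommGroup I] [Module R I], Module.Baer R I →
    ∀ f : I →ₗ[R] M, (∀ x, d (f x) = 0) → ∃ g : I →ₗ[R] M, ∀ x, d (g x) = f x

namespace TotallyAcyclic

variable {R : Type u} [Ring R]
variable {A B C : Type u} [AddCommGroup A] [Module R A] [AddCommGroup B] [Module R B]
  [AddCommGroup C] [Module R C] {dA : A →ₗ[R] A} {dB : B →ₗ[R] B} {dC : C →ₗ[R] C}

theorem d_d (h : TotallyAcyclic dA) (x : A) : dA (dA x) = 0 := (h.exact _).2 ⟨x, rfl⟩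

theorem of_exact_right {i : A →ₗ[R] B} {p : B →ₗ[R] C} (hi : Function.Injective i)
    (hp : Function.Surjective p) (hip : Function.Exact i p)
    (hdi : ∀ x, dB (i x) = i (dA x)) (hdp : ∀ x, dC (p x) = p (dB x))
    (hA : TotallyAcyclic dA) (hB : TotallyAcyclic dB) : TotallyAcyclic dC where
  baer := hA.baer.of_exact_right hi hp hip hB.baer
  exact x := by
    obtain ⟨b, rfl⟩ := hp x
    constructor
    · intro h
      rw [hdp] at h
      obtain ⟨a, ha⟩ := (hip _).1 h
      obtain ⟨a', rfl⟩ := (hA.exact a).1 (hi (by rw [← hdi, ha, hB.d_d, map_zero]))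
      obtain ⟨y, hy⟩ := (hB.exact (b - i a')).1 (by rw [map_sub, hdi, ha, sub_self])
      refine ⟨p y, ?_⟩
      rw [hdp, hy, map_sub, (hip (i a')).2 ⟨_, rfl⟩, sub_zero]
    · rintro ⟨y, hy⟩
      obtain ⟨b', rfl⟩ := hp y
      rw [← hy, hdp, hdp, hB.d_d, map_zero]
  lift I _ _ hI f hf := by
    obtain ⟨r, s, hr, hs, -⟩ := hA.baer.exists_section hi hp hip
    have h₁ : ∀ x, i (r (dB (s (f x)))) = dB (s (f x)) := fun x => by
      obtain ⟨a, ha⟩ := (hip (dB (s (f x)))).1 (by rw [← hdp, hs, hf])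
      rw [← ha, hr]
    obtain ⟨h, hh⟩ := hA.lift I hI (r ∘ₗ dB ∘ₗ s ∘ₗ f) (fun x => hi (by
      rw [← hdi]; simp only [LinearMap.comp_apply]; rw [h₁, hB.d_d, map_zero]))
    obtain ⟨g, hg⟩ := hB.lift I hI (s ∘ₗ f - i ∘ₗ h) (fun x => by
      simp only [LinearMap.sub_apply, LinearMap.comp_apply, map_sub]
      rw [hdi, hh]
      simp only [LinearMap.comp_apply]
      rw [h₁, sub_self])
    refine ⟨p ∘ₗ g, fun x => ?_⟩
    simp only [LinearMap.comp_apply]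
    rw [hdp, hg]
    simp only [LinearMap.sub_apply, LinearMap.comp_apply, map_sub]
    rw [hs, (hip _).2 ⟨_, rfl⟩, sub_zero]

theorem of_exact {i : A →ₗ[R] B} {p : B →ₗ[R] C} (hi : Function.Injective i)
    (hp : Function.Surjective p) (hip : Function.Exact i p)
    (hdi : ∀ x, dB (i x) = i (dA x)) (hdp : ∀ x, dC (p x) = p (dB x))
    (hdB : ∀ x, dB (dB x) = 0)
    (hA : TotallyAcyclic dA) (hC : TotallyAcyclic dC) : TotallyAcyclic dB where
  baer := hA.baer.of_exact hi hp hip hC.baer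
  exact x := by
    constructor
    · intro h
      obtain ⟨y, hy⟩ := (hC.exact (p x)).1 (by rw [hdp, h, map_zero])
      obtain ⟨b, rfl⟩ := hp y
      obtain ⟨a, ha⟩ := (hip (x - dB b)).1 (by rw [map_sub, ← hdp, hy, sub_self])
      obtain ⟨a', rfl⟩ := (hA.exact a).1 (hi (by
        rw [← hdi, ha, map_sub, h, hdB, sub_self, map_zero]))
      exact ⟨b + i a', by rw [map_add, hdi, ha, add_sub_cancel]⟩
    · rintro ⟨y, rfl⟩
      exact hdB y
  lift I _ _ hI f hf := by
    obtain ⟨r, s, hr, hs, -⟩ := hA.baer.exists_section hi hp hip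
    obtain ⟨g, hg⟩ := hC.lift I hI (p ∘ₗ f) (fun x => by
      simp only [LinearMap.comp_apply]; rw [hdp, hf, map_zero])
    have h₁ : ∀ x, i (r (f x - dB (s (g x)))) = f x - dB (s (g x)) := fun x => by
      obtain ⟨a, ha⟩ := (hip (f x - dB (s (g x)))).1 (by
        rw [map_sub, ← hdp, hs, hg]; simp)
      rw [← ha, hr]
    obtain ⟨h, hh⟩ := hA.lift I hI (r ∘ₗ (f - dB ∘ₗ s ∘ₗ g)) (fun x => hi (by
      rw [← hdi]
      simp only [LinearMap.comp_apply, LinearMap.sub_apply]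
      rw [h₁, map_sub, hf, hdB, sub_zero, map_zero]))
    refine ⟨s ∘ₗ g + i ∘ₗ h, fun x => ?_⟩
    simp only [LinearMap.comp_apply, LinearMap.add_apply, map_add]
    rw [hdi, hh]
    simp only [LinearMap.comp_apply, LinearMap.sub_apply]
    rw [h₁, add_sub_cancel]

theorem of_equiv (e : A ≃ₗ[R] B) (he : ∀ x, dB (e x) = e (dA x)) (hA : TotallyAcyclic dA) :
    TotallyAcyclic dB where
  baer := hA.baer.of_equiv e
  exact x := by
    obtain ⟨a, rfl⟩ := e.surjective x
    rw [he, EmbeddingLike.map_eq_zero_iff, hA.exact]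
    constructor
    · rintro ⟨y, rfl⟩
      exact ⟨e y, he y⟩
    · rintro ⟨y, hy⟩
      obtain ⟨b, rfl⟩ := e.surjective y
      exact ⟨b, e.injective (by rw [← he, hy])⟩
  lift I _ _ hI f hf := by
    obtain ⟨g, hg⟩ := hA.lift I hI (e.symm.toLinearMap ∘ₗ f) (fun x => e.injective (by
      rw [← he]; simp [hf]))
    exact ⟨e.toLinearMap ∘ₗ g, fun x => by simp [he, hg]⟩

theorem pi {ι : Type u} {M : ι → Type u} [∀ i, AddCommGroup (M i)] [∀ i, Module R (M i)]
    {d : ∀ i, M i →ₗ[R] M i} (h : ∀ i, TotallyAcyclic (d i)) :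
    TotallyAcyclic (LinearMap.pi fun i => d i ∘ₗ LinearMap.proj i) where
  baer := Module.Baer.pi fun i => (h i).baer
  exact x := by
    constructor
    · intro hx
      choose y hy using fun i => ((h i).exact (x i)).1 (congr_fun hx i)
      exact ⟨y, funext hy⟩
    · rintro ⟨y, rfl⟩
      exact funext fun i => (h i).d_d (y i)
  lift I _ _ hI f hf := by
    choose g hg using fun i => (h i).lift I hI (LinearMap.proj i ∘ₗ f)
      (fun x => congr_fun (hf x) i)
    exact ⟨LinearMap.pi g, fun x => funext fun i => hg i x⟩

end TotallyAcyclic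

section Closure

/-- A subset of `M` closed under a family of (possibly infinitary) operations. -/
def IsClosedUnder {O : Type u} {W : O → Type u} {M : Type u} (op : ∀ o, (W o → M) → M)
    (T : Set M) : Prop :=
  ∀ o v, (∀ w, v w ∈ T) → op o v ∈ T

theorem IsClosedUnder.inter {O : Type u} {W : O → Type u} {M : Type u} {op : ∀ o, (W o → M) → M}
    {S T : Set M} (hS : IsClosedUnder op S) (hT : IsClosedUnder op T) :
    IsClosedUnder op (S ∩ T) :=
  fun o v hv => ⟨hS o v fun w => (hv w).1, hT o v fun w => (hv w).2⟩

/-- The terms in one variable built from operations of arities `W`. -/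
def ClosureIndex {O : Type u} (W : O → Type u) : Type u :=
  WType fun o : Option O => Option.elim o PEmpty.{u + 1} W

theorem exists_isClosedUnder_range {O : Type u} {W : O → Type u} {M : Type u}
    (op : ∀ o, (W o → M) → M) (m : M) :
    ∃ e : ClosureIndex W → M, IsClosedUnder op (Set.range e) ∧ m ∈ Set.range e := by
  refine ⟨WType.elim M fun x => match x with
    | ⟨none, _⟩ => m
    | ⟨some o, v⟩ => op o v, fun o v hv => ?_, ⟨WType.mk none fun x => x.elim, rfl⟩⟩
  choose t ht using hv
  exact ⟨WType.mk (some o) t, congrArg (op o) (funext ht)⟩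

variable (R : Type u) [Ring R]

/-- Operations whose closed subsets are the injective submodules, for an injective module. -/
inductive BaerOp : Type u
  | zero : BaerOp
  | add : BaerOp
  | smul (r : R) : BaerOp
  | ext (I : Ideal R) : BaerOp

/-- The arity of an operation in `BaerOp R`. -/
def BaerOp.Arity : BaerOp R → Type u
  | zero => PEmpty
  | add => ULift Bool
  | smul _ => PUnit
  | ext I => I

variable {R} {M : Type u} [AddCommGroup M] [Module R M]

open Classical in
/-- The action of the operations in `BaerOp R` on a module. -/
noncomputable def BaerOp.act : ∀ o : BaerOp R, (o.Arity → M) → M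
  | zero, _ => 0
  | add, v => v ⟨true⟩ + v ⟨false⟩
  | smul r, v => r • v ⟨⟩
  | ext I, v => if h : ∃ m : M, ∀ r : I, v r = (r : R) • m then h.choose else 0

theorem BaerOp.act_ext_spec {I : Ideal R} {v : I → M} (h : ∃ m : M, ∀ r : I, v r = (r : R) • m)
    (r : I) : v r = (r : R) • BaerOp.act (.ext I) v := by
  have : BaerOp.act (.ext I) v = h.choose := dif_pos h
  rw [this]
  exact h.choose_spec r

/-- The submodule underlying a subset closed under `BaerOp.act`. -/
def IsClosedUnder.submodule {T : Set M} (hT : IsClosedUnder (BaerOp.act (R := R)) T) :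
    Submodule R M where
  carrier := T
  zero_mem' := hT .zero (fun x => x.elim) fun x => x.elim
  add_mem' {a b} ha hb := hT .add (fun x => cond x.down a b) fun x => by
    rcases x with ⟨_ | _⟩ <;> assumption
  smul_mem' r a ha := hT (.smul r) (fun _ => a) fun _ => ha

theorem IsClosedUnder.baer {T : Set M} (hT : IsClosedUnder (BaerOp.act (R := R)) T)
    (hM : Module.Baer R M) : Module.Baer R hT.submodule := fun I g => by
  obtain ⟨g', hg'⟩ := hM I (hT.submodule.subtype ∘ₗ g)
  have h : ∃ m : M, ∀ r : I, (g r : M) = (r : R) • m := ⟨g' 1, fun r => by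
    rw [← map_smul, smul_eq_mul, mul_one, hg' r r.2]; rfl⟩
  refine ⟨LinearMap.toSpanSingleton R hT.submodule ⟨BaerOp.act (.ext I) fun r : I => (g r : M),
    hT (.ext I) _ fun r => (g r).2⟩, fun x hx => Subtype.ext ?_⟩
  exact (BaerOp.act_ext_spec h ⟨x, hx⟩).symm

theorem Module.Baer.exists_small_submodule (hM : Module.Baer R M) (x : M) :
    ∃ N : Submodule R M, x ∈ N ∧ Module.Baer R N ∧
      ∃ e : ClosureIndex (BaerOp.Arity R) → N, Function.Surjective e := by
  obtain ⟨e, he, hx⟩ := exists_isClosedUnder_range (BaerOp.act (R := R)) x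
  refine ⟨he.submodule, hx, he.baer hM, fun k => ⟨e k, k, rfl⟩, ?_⟩
  rintro ⟨_, k, rfl⟩
  exact ⟨k, rfl⟩

end Closure

section LiftTest

variable {R : Type u} [Ring R]
variable {A B : Type u} [AddCommGroup A] [Module R A] [AddCommGroup B] [Module R B]

theorem DFinsupp.forall_exists_lift_iff {ι : Type u} (Q : ι → Type u) [∀ i, AddCommGroup (Q i)]
    [∀ i, Module R (Q i)] (p : A →ₗ[R] B) :
    (∀ f : (Π₀ i, Q i) →ₗ[R] B, ∃ g : (Π₀ i, Q i) →ₗ[R] A, ∀ x, p (g x) = f x) ↔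
      ∀ i, ∀ f : Q i →ₗ[R] B, ∃ g : Q i →ₗ[R] A, ∀ x, p (g x) = f x := by
  classical
  refine ⟨fun h i f => ?_, fun h f => ?_⟩
  · let k : ∀ j : ι, Q j →ₗ[R] B := Function.update 0 i f
    obtain ⟨g, hg⟩ := h (DFinsupp.lsum ℕ k)
    refine ⟨g ∘ₗ DFinsupp.lsingle i, fun x => ?_⟩
    simp [hg, k]
  · choose g hg using fun i => h i (f ∘ₗ DFinsupp.lsingle i)
    refine ⟨DFinsupp.lsum ℕ g, fun x => ?_⟩
    have : p ∘ₗ DFinsupp.lsum ℕ g = f := DFinsupp.lhom_ext fun S y => by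
      simpa using hg S y
    exact LinearMap.congr_fun this x

variable [IsNoetherianRing R]

theorem exists_lift_of_small (p : A →ₗ[R] B)
    (hp : ∀ (N : Type u) [AddCommGroup N] [Module R N], Module.Baer R N →
      (∃ e : ClosureIndex (BaerOp.Arity R) → N, Function.Surjective e) →
        ∀ f : N →ₗ[R] B, ∃ g : N →ₗ[R] A, ∀ x, p (g x) = f x)
    (I : Type u) [AddCommGroup I] [Module R I] (hI : Module.Baer R I) (f : I →ₗ[R] B) :
    ∃ g : I →ₗ[R] A, ∀ x, p (g x) = f x := by
  let 𝒮 : Set (I →ₗ.[R] A) := {g | Module.Baer R g.domain ∧ ∀ x : g.domain, p (g x) = f x}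
  have hbot : (⊥ : I →ₗ.[R] A) ∈ 𝒮 := by
    refine ⟨fun J g => ⟨0, fun x hx => ?_⟩, ?_⟩
    · exact Subsingleton.elim (α := (⊥ : Submodule R I)) _ _
    · rintro ⟨x, hx⟩
      obtain rfl := (Submodule.mem_bot R).1 hx
      have : (⟨0, hx⟩ : (⊥ : I →ₗ.[R] A).domain) = 0 := rfl
      rw [this]
      simp
  obtain ⟨g, -, ⟨hg, hgf⟩, hmax⟩ := zorn_le_nonempty₀ 𝒮 (fun c hc hchain y hy => by
    have hdir := hchain.directedOn
    have hmem : ∀ x : (LinearPMap.sSup c hdir).domain, ∃ g ∈ c, (x : I) ∈ g.domain := fun x =>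
      (LinearPMap.mem_domain_sSup_iff ⟨y, hy⟩ hdir).1 x.2
    refine ⟨LinearPMap.sSup c hdir, ⟨?_, fun x => ?_⟩, fun z hz => LinearPMap.le_sSup hdir hz⟩
    · rw [LinearPMap.domain_sSup]
      refine Submodule.baer_sSup ⟨_, y, hy, rfl⟩ ?_ ?_
      · rintro _ ⟨a, ha, rfl⟩ _ ⟨b, hb, rfl⟩
        obtain ⟨d, hd, h₁, h₂⟩ := hdir a ha b hb
        exact ⟨_, ⟨d, hd, rfl⟩, h₁.1, h₂.1⟩
      · rintro _ ⟨a, ha, rfl⟩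
        exact (hc ha).1
    · obtain ⟨g, hg, hx⟩ := hmem x
      have := LinearPMap.sSup_apply hdir hg ⟨x, hx⟩
      rw [← (hc hg).2 ⟨x, hx⟩, ← this]) ⊥ hbot
  obtain ⟨T, hT⟩ : ∃ T : Submodule R I, IsCompl g.domain T := by
    obtain ⟨r, hr⟩ := hg.extension_property g.domain.subtype Subtype.val_injective LinearMap.id
    exact ⟨_, LinearMap.isCompl_of_proj (f := r) fun x => LinearMap.congr_fun hr x⟩
  have hTB : Module.Baer R T := hI.of_retract T.subtype (Submodule.projectionOnto T _ hT.symm) (by simp)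
  have hTbot : T = ⊥ := by
    rw [eq_bot_iff]
    intro t ht
    obtain ⟨N, htN, hN, e, he⟩ := hTB.exists_small_submodule ⟨t, ht⟩
    let N' := N.map T.subtype
    let eqv : N ≃ₗ[R] N' := Submodule.equivMapOfInjective _ T.injective_subtype N
    have hN' : Module.Baer R N' := hN.of_equiv eqv
    obtain ⟨k, hk⟩ := hp N' hN' ⟨eqv ∘ e, eqv.surjective.comp he⟩ (f ∘ₗ N'.subtype)
    have hN'T : N' ≤ T := Submodule.map_subtype_le T N
    have hdisj : Disjoint g.domain N' := hT.disjoint.mono_right hN'T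
    let k' : I →ₗ.[R] A := ⟨N', k⟩
    have hagree := LinearPMap.sup_h_of_disjoint g k' hdisj
    have hle : g.sup k' hagree ≤ g := hmax ⟨?_, ?_⟩ (LinearPMap.left_le_sup _ _ _)
    · have h₁ : t ∈ g.domain := hle.1 (LinearPMap.right_le_sup g k' hagree |>.1
        (⟨⟨t, ht⟩, htN, rfl⟩ : t ∈ N'))
      exact hT.disjoint.le_bot ⟨h₁, ht⟩
    · refine (hg.prod hN').of_equiv (LinearEquiv.ofBijective
        ((Submodule.inclusion le_sup_left).coprod (Submodule.inclusion le_sup_right)) ⟨?_, ?_⟩)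
      · rw [← LinearMap.ker_eq_bot, LinearMap.ker_eq_bot']
        rintro ⟨a, b⟩ hab
        have hab' : (a : I) + b = 0 := congrArg Subtype.val hab
        have ha : (a : I) = 0 := hdisj.le_bot ⟨a.2, by
          rw [eq_neg_of_add_eq_zero_left hab']; exact N'.neg_mem b.2⟩
        rw [ha, zero_add] at hab'
        exact Prod.ext (Subtype.ext ha) (Subtype.ext hab')
      · rintro ⟨x, hx⟩
        obtain ⟨a, ha, b, hb, rfl⟩ := Submodule.mem_sup.1 hx
        exact ⟨(⟨a, ha⟩, ⟨b, hb⟩), rfl⟩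
    · rintro ⟨x, hx⟩
      obtain ⟨a, ha, b, hb, rfl⟩ := Submodule.mem_sup.1 hx
      have h₁ : (g.sup k' hagree) ⟨a + b, hx⟩ = g ⟨a, ha⟩ + k' ⟨b, hb⟩ :=
        LinearPMap.sup_apply hagree ⟨a, ha⟩ ⟨b, hb⟩ ⟨a + b, hx⟩ rfl
      have h₂ : p (k' ⟨b, hb⟩) = f b := hk ⟨b, hb⟩
      refine (congrArg p h₁).trans ?_
      rw [map_add, hgf ⟨a, ha⟩, h₂, map_add]
  have htop : g.domain = ⊤ := by
    have := hT.sup_eq_top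
    rwa [hTbot, sup_bot_eq] at this
  exact ⟨g.toFun ∘ₗ (LinearEquiv.ofTop _ htop).symm.toLinearMap, fun x => hgf ⟨x, _⟩⟩

variable (R) in
/-- The submodules of a large free module with injective quotients. -/
abbrev InjectiveQuotientIndex : Type u :=
  {S : Submodule R (ClosureIndex (BaerOp.Arity R) →₀ R) //
    Module.Baer R ((ClosureIndex (BaerOp.Arity R) →₀ R) ⧸ S)}

variable (R) in
/-- A module detects whether all maps from injective modules lift along a given map. -/
def IsLiftTest (E : Type u) [AddCommGroup E] [Module R E] : Prop :=
  ∀ {A B : Type u} [AddCommGroup A] [Module R A] [AddCommGroup B] [Module R B]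
    (p : A →ₗ[R] B), (∀ f : E →ₗ[R] B, ∃ g : E →ₗ[R] A, ∀ x, p (g x) = f x) ↔
    ∀ (I : Type u) [AddCommGroup I] [Module R I], Module.Baer R I →
      ∀ f : I →ₗ[R] B, ∃ g : I →ₗ[R] A, ∀ x, p (g x) = f x

variable (R) in
theorem exists_isLiftTest : ∃ (E : Type u) (_ : AddCommGroup E) (_ : Module R E),
    IsLiftTest R E := by
  let Q : InjectiveQuotientIndex R → Type u := fun S => (ClosureIndex (BaerOp.Arity R) →₀ R) ⧸ S.1
  let _ : ∀ S, AddCommGroup (Q S) := fun S => Submodule.Quotient.addCommGroup S.1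
  let _ : ∀ S, Module R (Q S) := fun S => Submodule.Quotient.module S.1
  refine ⟨Π₀ S, Q S, inferInstance, inferInstance, fun {A B} _ _ _ _ p =>
    (DFinsupp.forall_exists_lift_iff Q p).trans
    ⟨fun h => exists_lift_of_small p fun N _ _ hN he f => ?_, fun h S => h (Q S) S.2⟩⟩
  obtain ⟨e, he⟩ := he
  have hq : Function.Surjective (Finsupp.linearCombination R e) := fun y => by
    obtain ⟨k, rfl⟩ := he y
    exact ⟨Finsupp.single k 1, by simp⟩
  let eqv := (Finsupp.linearCombination R e).quotKerEquivOfSurjective hq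
  obtain ⟨g, hg⟩ := h ⟨LinearMap.ker (Finsupp.linearCombination R e), hN.of_equiv eqv.symm⟩
    (f ∘ₗ eqv.toLinearMap)
  refine ⟨g ∘ₗ eqv.symm.toLinearMap, fun x => ?_⟩
  have := hg (eqv.symm x)
  simpa using this

end LiftTest

section Subobjects

variable {R : Type u} [Ring R] {M : Type u} [AddCommGroup M] [Module R M]

/-- A submodule which is stable under `d` and totally acyclic under the restricted differential. -/
def TotallyAcyclicOn (d : M →ₗ[R] M) (D : Submodule R M) : Prop :=
  ∃ h : ∀ x ∈ D, d x ∈ D, TotallyAcyclic (d.restrict h)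

variable (R) in
/-- Operations whose closed subsets are totally acyclic submodules, for a totally acyclic
differential module. -/
inductive AcyclicOp (E : Type u) : Type u
  | baer (o : BaerOp R) : AcyclicOp E
  | diff : AcyclicOp E
  | pre : AcyclicOp E
  | lift (e : E) : AcyclicOp E

variable (R) in
/-- The arity of an operation in `AcyclicOp R E`. -/
def AcyclicOp.Arity (E : Type u) : AcyclicOp R E → Type u
  | baer o => o.Arity
  | diff => PUnit
  | pre => PUnit
  | lift _ => E

variable {E : Type u} [AddCommGroup E] [Module R E]

open Classical in
/-- The action of the operations in `AcyclicOp R E` on a differential module. -/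
noncomputable def AcyclicOp.act (d : M →ₗ[R] M) : ∀ o : AcyclicOp R E, (o.Arity → M) → M
  | baer o, v => o.act v
  | diff, v => d (v ⟨⟩)
  | pre, v => if h : ∃ y, d y = v ⟨⟩ then h.choose else 0
  | lift e, v => if h : ∃ g : E →ₗ[R] M, ∀ x, d (g x) = v x then h.choose e else 0

theorem AcyclicOp.d_act_pre {d : M →ₗ[R] M} {v : PUnit → M} (h : ∃ y, d y = v ⟨⟩) :
    d (AcyclicOp.act d (.pre : AcyclicOp R E) v) = v ⟨⟩ := by
  have : AcyclicOp.act d (.pre : AcyclicOp R E) v = h.choose := dif_pos h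
  rw [this]
  exact h.choose_spec

theorem AcyclicOp.exists_act_lift {d : M →ₗ[R] M} {v : E → M}
    (h : ∃ g : E →ₗ[R] M, ∀ x, d (g x) = v x) :
    ∃ g : E →ₗ[R] M, (∀ x, d (g x) = v x) ∧
      ∀ e, AcyclicOp.act d (.lift e : AcyclicOp R E) v = g e :=
  ⟨h.choose, h.choose_spec, fun _ => dif_pos h⟩

theorem LinearMap.forall_lift_ker_iff {d : M →ₗ[R] M} (hd : ∀ x, d (d x) = 0)
    (I : Type u) [AddCommGroup I] [Module R I] :
    (∀ f : I →ₗ[R] LinearMap.ker d, ∃ g : I →ₗ[R] M, ∀ x, d.codRestrict (LinearMap.ker d) hd (g x)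
      = f x) ↔
    ∀ f : I →ₗ[R] M, (∀ x, d (f x) = 0) → ∃ g : I →ₗ[R] M, ∀ x, d (g x) = f x := by
  constructor
  · intro h f hf
    obtain ⟨g, hg⟩ := h (f.codRestrict _ hf)
    exact ⟨g, fun x => congrArg Subtype.val (hg x)⟩
  · intro h f
    obtain ⟨g, hg⟩ := h (Submodule.subtype _ ∘ₗ f) fun x => (f x).2
    exact ⟨g, fun x => Subtype.ext (hg x)⟩

theorem IsLiftTest.lift (hE : IsLiftTest R E) {d : M →ₗ[R] M} (hd : ∀ x, d (d x) = 0)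
    (h : ∀ f : E →ₗ[R] M, (∀ x, d (f x) = 0) → ∃ g : E →ₗ[R] M, ∀ x, d (g x) = f x)
    (I : Type u) [AddCommGroup I] [Module R I] (hI : Module.Baer R I)
    (f : I →ₗ[R] M) (hf : ∀ x, d (f x) = 0) : ∃ g : I →ₗ[R] M, ∀ x, d (g x) = f x :=
  (LinearMap.forall_lift_ker_iff hd I).1
    ((hE _).1 ((LinearMap.forall_lift_ker_iff hd E).2 h) I hI) f hf

theorem IsLiftTest.lift_self (hE : IsLiftTest R E) {d : M →ₗ[R] M} (h : TotallyAcyclic d)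
    (f : E →ₗ[R] M) (hf : ∀ x, d (f x) = 0) : ∃ g : E →ₗ[R] M, ∀ x, d (g x) = f x :=
  (LinearMap.forall_lift_ker_iff h.d_d E).1
    ((hE _).2 fun I _ _ hI => (LinearMap.forall_lift_ker_iff h.d_d I).2 (h.lift I hI)) f hf

theorem IsClosedUnder.exists_totallyAcyclicOn (hE : IsLiftTest R E) {d : M →ₗ[R] M}
    (hd : TotallyAcyclic d) {T : Set M} (hT : IsClosedUnder (AcyclicOp.act (E := E) d) T) :
    ∃ D : Submodule R M, (D : Set M) = T ∧ TotallyAcyclicOn d D := by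
  have hB : IsClosedUnder (BaerOp.act (R := R)) T := fun o v hv => hT (.baer o) v hv
  have hs : ∀ x ∈ hB.submodule, d x ∈ hB.submodule := fun x hx => hT .diff (fun _ => x) fun _ => hx
  have hdd : ∀ x, d.restrict hs (d.restrict hs x) = 0 := fun x => Subtype.ext (hd.d_d x)
  refine ⟨hB.submodule, rfl, hs, hB.baer hd.baer, fun x => ⟨fun hx => ?_, ?_⟩,
    hE.lift hdd fun f hf => ?_⟩
  · have := (hd.exact x).1 (congrArg Subtype.val hx)
    exact ⟨⟨_, hT .pre (fun _ => (x : M)) fun _ => x.2⟩,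
      Subtype.ext (AcyclicOp.d_act_pre (E := E) (v := fun _ => (x : M)) this)⟩
  · rintro ⟨y, rfl⟩
    exact hdd y
  · obtain ⟨g, hg, hga⟩ := AcyclicOp.exists_act_lift (v := fun e => (f e : M))
      (hE.lift_self hd (hB.submodule.subtype ∘ₗ f) fun x => congrArg Subtype.val (hf x))
    refine ⟨g.codRestrict hB.submodule fun e => ?_, fun x => Subtype.ext (hg x)⟩
    rw [← hga]
    exact hT (.lift e) _ fun x => (f x).2

end Subobjects

section Complexes

variable {R : Type u} [Ring R]

theorem ChainComplex.moduleCat_exactAt_iff (C : ChainComplex (ModuleCat.{u} R) ℤ) {i j k : ℤ}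
    (hi : j + 1 = i) (hk : k + 1 = j) :
    C.ExactAt j ↔ ∀ x : C.X j, C.d j k x = 0 → ∃ y : C.X i, C.d i j y = x := by
  rw [C.exactAt_iff' i j k (by simp [hi]) (by simp [← hk]), ShortComplex.moduleCat_exact_iff]
  rfl

theorem ChainComplex.coyoneda_exactAt_iff (C : ChainComplex (ModuleCat.{u} R) ℤ)
    (I : ModuleCat.{u} R) {i j k : ℤ} (hi : j + 1 = i) (hk : k + 1 = j) :
    (((preadditiveCoyoneda.obj (Opposite.op I)).mapHomologicalComplex _).obj C).ExactAt j ↔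
      ∀ f : I ⟶ C.X j, f ≫ C.d j k = 0 → ∃ g : I ⟶ C.X i, g ≫ C.d i j = f := by
  rw [HomologicalComplex.exactAt_iff' _ i j k (by simp [hi]) (by simp [← hk]),
    ShortComplex.ab_exact_iff]
  rfl

theorem ModuleCat.injective_iff_baer (M : ModuleCat.{u} R) : Injective M ↔ Module.Baer R M := by
  rw [Module.Baer.iff_injective, Module.injective_iff_injective_object]

theorem IsGorensteinInjective.of_iso {G G' : ModuleCat.{u} R} (e : G' ≅ G)
    (h : IsGorensteinInjective G) : IsGorensteinInjective G' := by
  obtain ⟨C, h₁, h₂, h₃, ⟨f⟩⟩ := h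
  exact ⟨C, h₁, h₂, h₃, ⟨e ≪≫ f⟩⟩

open Classical in
theorem TotallyAcyclic.isGorensteinInjective {M : Type u} [AddCommGroup M] [Module R M]
    {d : M →ₗ[R] M} (hd : TotallyAcyclic d) :
    IsGorensteinInjective (ModuleCat.of R (LinearMap.ker d)) := by
  let C : ChainComplex (ModuleCat.{u} R) ℤ :=
    { X _ := ModuleCat.of R M
      d i j := if j + 1 = i then ModuleCat.ofHom d else 0
      shape i j h := if_neg h
      d_comp_d' i j k hij hjk := by
        have h₁ : j + 1 = i := hij
        have h₂ : k + 1 = j := hjk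
        rw [if_pos h₁, if_pos h₂]
        ext x
        exact hd.d_d x }
  have hC : ∀ i j, j + 1 = i → C.d i j = ModuleCat.ofHom d := fun i j h => if_pos h
  refine ⟨C, fun n => (ModuleCat.injective_iff_baer _).2 hd.baer, fun n => ?_, fun I hI n => ?_,
    ⟨?_⟩⟩
  · rw [ChainComplex.moduleCat_exactAt_iff C rfl (sub_add_cancel n 1), hC _ _ rfl,
      hC _ _ (sub_add_cancel n 1)]
    exact fun x hx => (hd.exact x).1 hx
  · rw [ChainComplex.coyoneda_exactAt_iff C I rfl (sub_add_cancel n 1), hC _ _ rfl,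
      hC _ _ (sub_add_cancel n 1)]
    intro f hf
    obtain ⟨g, hg⟩ := hd.lift I ((ModuleCat.injective_iff_baer _).1 hI) f.hom
      fun x => LinearMap.congr_fun (congrArg ModuleCat.Hom.hom hf) x
    exact ⟨ModuleCat.ofHom g, ModuleCat.hom_ext (LinearMap.ext hg)⟩
  · have h : LinearMap.ker d = LinearMap.ker (C.d 0 (-1)).hom := by rw [hC 0 (-1) rfl]; rfl
    exact (LinearEquiv.ofEq _ _ h).toModuleIso ≪≫ (ModuleCat.kernelIsoKer (C.d 0 (-1))).symm

theorem IsGorensteinInjective.exists_totallyAcyclic {G : ModuleCat.{u} R}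
    (h : IsGorensteinInjective G) :
    ∃ (M : Type u) (_ : AddCommGroup M) (_ : Module R M) (d : M →ₗ[R] M) (i : G →ₗ[R] M)
      (r : LinearMap.ker d →ₗ[R] G), TotallyAcyclic d ∧
        ∃ hi : ∀ x, d (i x) = 0, ∀ x, r ⟨i x, hi x⟩ = x := by
  obtain ⟨C, h₁, h₂, h₃, ⟨e⟩⟩ := h
  let d : (∀ n, C.X n) →ₗ[R] ∀ n, C.X n :=
    LinearMap.pi fun n => (C.d (n + 1) n).hom ∘ₗ LinearMap.proj (n + 1)
  have hd : ∀ (x : ∀ n, C.X n) n, d x n = C.d (n + 1) n (x (n + 1)) := fun _ _ => rfl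
  have hcast : ∀ x : ∀ n, C.X n, d x = 0 → ∀ i j, j + 1 = i → C.d i j (x i) = 0 := by
    rintro x hx _ j rfl
    rw [← hd, hx]; rfl
  let e' := e ≪≫ ModuleCat.kernelIsoKer (C.d 0 (-1))
  let i : G →ₗ[R] ∀ n, C.X n := LinearMap.single R (fun n => C.X n) 0 ∘ₗ
    (LinearMap.ker (C.d 0 (-1)).hom).subtype ∘ₗ e'.hom.hom
  have hi : ∀ x, d (i x) = 0 := fun x => by
    funext n
    rw [hd]
    by_cases hn : n = -1
    · subst hn
      exact (e'.hom.hom x).2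
    · have : i x (n + 1) = 0 := Pi.single_eq_of_ne (by omega) _
      rw [this, map_zero]; rfl
  let r : LinearMap.ker d →ₗ[R] G := e'.inv.hom ∘ₗ
    (LinearMap.proj 0 ∘ₗ (LinearMap.ker d).subtype).codRestrict (LinearMap.ker (C.d 0 (-1)).hom)
      fun x => hcast x x.2 0 (-1) rfl
  refine ⟨∀ n, C.X n, inferInstance, inferInstance, d, i, r, ⟨?_, fun x => ⟨fun hx => ?_, ?_⟩,
    fun I _ _ hI f hf => ?_⟩, hi, fun x => ?_⟩
  · exact Module.Baer.pi fun n => (ModuleCat.injective_iff_baer _).1 (h₁ n)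
  · have h' : ∀ n, ∃ y : C.X (n + 1), C.d (n + 1) n y = x n := fun n =>
      (ChainComplex.moduleCat_exactAt_iff C rfl (sub_add_cancel n 1)).1 (h₂ n) (x n)
        (hcast x hx _ _ (sub_add_cancel n 1))
    have h'' : ∀ n m, m + 1 = n → ∃ y : C.X n, C.d n m y = x m := by
      rintro _ m rfl
      exact h' m
    choose y hy using fun n => h'' n (n - 1) (sub_add_cancel n 1)
    refine ⟨y, funext fun n => ?_⟩
    have key : ∀ m, m = n → C.d (n + 1) m (y (n + 1)) = x m → C.d (n + 1) n (y (n + 1)) = x n := by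
      rintro _ rfl h
      exact h
    exact key _ (add_sub_cancel_right n 1) (hy (n + 1))
  · rintro ⟨y, rfl⟩
    funext n
    rw [hd, hd, ← ConcreteCategory.comp_apply, C.d_comp_d]
    rfl
  · have h'' : ∀ n m, m + 1 = n → ∃ g : I →ₗ[R] C.X n, ∀ z, C.d n m (g z) = f z m := by
      rintro _ m rfl
      obtain ⟨g, hg⟩ := (ChainComplex.coyoneda_exactAt_iff C (ModuleCat.of R I) rfl
        (sub_add_cancel m 1)).1 (h₃ (ModuleCat.of R I) ((ModuleCat.injective_iff_baer _).2 hI) m)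
        (ModuleCat.ofHom (LinearMap.proj m ∘ₗ f)) (by
          ext z
          exact hcast (f z) (hf z) _ _ (sub_add_cancel m 1))
      exact ⟨g.hom, fun z => LinearMap.congr_fun (congrArg ModuleCat.Hom.hom hg) z⟩
    choose g hg using fun n => h'' n (n - 1) (sub_add_cancel n 1)
    refine ⟨LinearMap.pi g, fun z => funext fun n => ?_⟩
    have key : ∀ m, m = n → C.d (n + 1) m (g (n + 1) z) = f z m →
        C.d (n + 1) n (g (n + 1) z) = f z n := by
      rintro _ rfl h
      exact h
    exact key _ (add_sub_cancel_right n 1) (hg (n + 1) z)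
  · have h₀ : i x 0 = (e'.hom.hom x : C.X 0) := by
      simp only [i, LinearMap.comp_apply, LinearMap.coe_single, Pi.single_eq_same]
      rfl
    have : r ⟨i x, hi x⟩ = e'.inv.hom (e'.hom.hom x) := congrArg e'.inv.hom (Subtype.ext h₀)
    rw [this, ← ModuleCat.comp_apply, e'.hom_inv_id]
    rfl

end Complexes

section Unions

variable {R : Type u} [Ring R]

theorem IsGorensteinInjective.exists_lift {G : ModuleCat.{u} R} (hG : IsGorensteinInjective G)
    {B C I : Type u} [AddCommGroup B] [Module R B] [AddCommGroup C] [Module R C]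
    [AddCommGroup I] [Module R I] {i : G →ₗ[R] B} {p : B →ₗ[R] C} (hi : Function.Injective i)
    (hp : Function.Surjective p) (hip : Function.Exact i p) (hI : Module.Baer R I)
    (f : I →ₗ[R] C) : ∃ g : I →ₗ[R] B, ∀ x, p (g x) = f x := by
  obtain ⟨M, _, _, d, j, r, hd, hj, hr⟩ := hG.exists_totallyAcyclic
  obtain ⟨h, hh⟩ := hd.baer.extension_property i hi j
  replace hh : ∀ a, h (i a) = j a := fun a => LinearMap.congr_fun hh a
  obtain ⟨k, hk⟩ := LinearMap.exists_comp_eq_of_ker_le hp (q := d ∘ₗ h) fun b hb => by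
    obtain ⟨a, rfl⟩ := (hip b).1 hb
    rw [LinearMap.comp_apply, hh, hj]
  obtain ⟨g, hg⟩ := hd.lift I hI (k ∘ₗ f) fun x => by
    obtain ⟨b, hb⟩ := hp (f x)
    rw [LinearMap.comp_apply, ← hb, hk]
    exact hd.d_d _
  let P : Submodule R (B × I) :=
    LinearMap.ker (p ∘ₗ LinearMap.fst R B I - f ∘ₗ LinearMap.snd R B I)
  have hP : ∀ x : P, p x.1.1 = f x.1.2 := fun x => sub_eq_zero.1 x.2
  let c : P →ₗ[R] LinearMap.ker d :=
    ((h ∘ₗ LinearMap.fst R B I - g ∘ₗ LinearMap.snd R B I) ∘ₗ P.subtype).codRestrict _ fun x => by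
      change d (h x.1.1 - g x.1.2) = 0
      rw [map_sub, hg, LinearMap.comp_apply, ← hP, hk]
      exact sub_self _
  have hsurj : Function.Surjective (LinearMap.snd R B I ∘ₗ P.subtype) := fun z => by
    obtain ⟨b, hb⟩ := hp (f z)
    exact ⟨⟨(b, z), sub_eq_zero.2 hb⟩, rfl⟩
  obtain ⟨s, hs⟩ := LinearMap.exists_comp_eq_of_ker_le hsurj
    (q := LinearMap.fst R B I ∘ₗ P.subtype - i ∘ₗ r ∘ₗ c) fun x hx => by
      obtain ⟨⟨b, z⟩, hbz⟩ := x
      obtain rfl : z = 0 := hx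
      have hb : p b = 0 := (sub_eq_zero.1 hbz).trans (map_zero f)
      obtain ⟨a, rfl⟩ := (hip b).1 hb
      have : c ⟨(i a, 0), hbz⟩ = ⟨j a, hj a⟩ := Subtype.ext (by
        change h (i a) - g 0 = j a
        rw [map_zero, sub_zero, hh])
      change i a - i (r (c ⟨(i a, 0), hbz⟩)) = 0
      rw [this, hr, sub_self]
  refine ⟨s, fun z => ?_⟩
  obtain ⟨x, rfl⟩ := hsurj z
  rw [hs]
  change p (x.1.1 - i (r (c x))) = f x.1.2
  rw [map_sub, hip.apply_apply_eq_zero, sub_zero, hP]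

theorem TotallyAcyclic.of_isGorensteinInjective {M : Type u} [AddCommGroup M] [Module R M]
    {d : M →ₗ[R] M} (hM : Module.Baer R M) (hd : ∀ x, d x = 0 ↔ ∃ y, d y = x)
    (h : IsGorensteinInjective (ModuleCat.of R (LinearMap.ker d))) : TotallyAcyclic d where
  baer := hM
  exact := hd
  lift I _ _ hI f hf := by
    have hdd : ∀ x, d (d x) = 0 := fun x => (hd _).2 ⟨x, rfl⟩
    obtain ⟨g, hg⟩ := h.exists_lift (i := (LinearMap.ker d).subtype)
      (p := d.codRestrict (LinearMap.ker d) hdd) Subtype.val_injective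
      (fun x => by
        obtain ⟨y, hy⟩ := (hd x).1 x.2
        exact ⟨y, Subtype.ext hy⟩)
      (fun x => ⟨fun hx => ⟨⟨x, congrArg Subtype.val hx⟩, rfl⟩, by
        rintro ⟨y, rfl⟩
        exact Subtype.ext y.2⟩)
      hI (f.codRestrict _ hf)
    exact ⟨g, fun x => congrArg Subtype.val (hg x)⟩

variable (R) in
/-- Direct limits of Gorenstein injective modules are Gorenstein injective. -/
def GorensteinInjectiveClosed : Prop :=
  ∀ (ι : Type u) [Preorder ι] [IsDirected ι (· ≤ ·)] [Nonempty ι] (F : ι ⥤ ModuleCat.{u} R),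
    (∀ i, IsGorensteinInjective (F.obj i)) → IsGorensteinInjective (colimit F)

open Classical in
theorem GorensteinInjectiveClosed.isGorensteinInjective_sSup (hR : GorensteinInjectiveClosed R) {M : Type u}
    [AddCommGroup M] [Module R M] {𝒮 : Set (Submodule R M)} (hne : 𝒮.Nonempty)
    (hdir : DirectedOn (· ≤ ·) 𝒮)
    (h : ∀ D ∈ 𝒮, IsGorensteinInjective (ModuleCat.of R D)) :
    IsGorensteinInjective (ModuleCat.of R (sSup 𝒮 : Submodule R M)) := by
  have : Nonempty 𝒮 := hne.to_subtype
  have : IsDirected 𝒮 (· ≤ ·) := directedOn_univ_iff.1 fun a _ b _ => by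
    obtain ⟨c, hc, h₁, h₂⟩ := hdir a a.2 b b.2
    exact ⟨⟨c, hc⟩, trivial, h₁, h₂⟩
  let f : ∀ D D' : 𝒮, D ≤ D' → D.1 →ₗ[R] D'.1 := fun D D' hDD' => Submodule.inclusion hDD'
  have : DirectedSystem (fun D : 𝒮 => D.1) fun i j h => f i j h :=
    ⟨fun _ _ => rfl, fun _ _ _ _ _ _ => rfl⟩
  have h₁ := hR 𝒮 (ModuleCat.directLimitDiagram (fun D : 𝒮 => D.1) f) fun D => h D.1 D.2
  have e₁ := (ModuleCat.directLimitIsColimit (fun D : 𝒮 => D.1) f).coconePointUniqueUpToIso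
    (colimit.isColimit _)
  let φ : Module.DirectLimit (fun D : 𝒮 => D.1) f →ₗ[R] (sSup 𝒮 : Submodule R M) :=
    Module.DirectLimit.lift R 𝒮 _ f (fun D => Submodule.inclusion (le_sSup D.2))
      fun _ _ _ _ => rfl
  have hφ : Function.Bijective φ := by
    refine ⟨Module.DirectLimit.lift_injective _ _ fun D => Submodule.inclusion_injective _, ?_⟩
    rintro ⟨x, hx⟩
    obtain ⟨D, hD, hxD⟩ := (Submodule.mem_sSup_of_directed hne hdir).1 hx
    refine ⟨Module.DirectLimit.of R 𝒮 (fun D : 𝒮 => D.1) f ⟨D, hD⟩ ⟨x, hxD⟩, ?_⟩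
    exact Module.DirectLimit.lift_of ..
  exact (h₁.of_iso e₁).of_iso (LinearEquiv.ofBijective φ hφ).symm.toModuleIso

theorem GorensteinInjectiveClosed.totallyAcyclicOn_sSup [IsNoetherianRing R] (hR : GorensteinInjectiveClosed R) {M : Type u}
    [AddCommGroup M] [Module R M] {d : M →ₗ[R] M} {𝒮 : Set (Submodule R M)} (hne : 𝒮.Nonempty)
    (hdir : DirectedOn (· ≤ ·) 𝒮) (h : ∀ D ∈ 𝒮, TotallyAcyclicOn d D) :
    TotallyAcyclicOn d (sSup 𝒮) := by
  have hmem := fun x => Submodule.mem_sSup_of_directed (z := x) hne hdir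
  have hst : ∀ x ∈ (sSup 𝒮 : Submodule R M), d x ∈ (sSup 𝒮 : Submodule R M) := by
    intro x hx
    obtain ⟨D, hD, hxD⟩ := (hmem x).1 hx
    exact (hmem _).2 ⟨D, hD, (h D hD).1 x hxD⟩
  refine ⟨hst, .of_isGorensteinInjective
    (Submodule.baer_sSup hne hdir fun D hD => (h D hD).2.baer) ?_ ?_⟩
  · rintro ⟨x, hx⟩
    constructor
    · intro hdx
      obtain ⟨D, hD, hxD⟩ := (hmem x).1 hx
      have hdx' : d x = 0 := congrArg Subtype.val hdx
      obtain ⟨y, hy⟩ := ((h D hD).2.exact ⟨x, hxD⟩).1 (Subtype.ext hdx')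
      have hy' : d y = x := congrArg Subtype.val hy
      exact ⟨⟨y, le_sSup hD y.2⟩, Subtype.ext hy'⟩
    · rintro ⟨⟨y, hy⟩, hyx⟩
      obtain ⟨D, hD, hyD⟩ := (hmem y).1 hy
      have hdd : d (d y) = 0 := congrArg Subtype.val ((h D hD).2.d_d ⟨y, hyD⟩)
      rw [← hyx]
      exact Subtype.ext hdd
  · have hs := hR.isGorensteinInjective_sSup (𝒮 := (fun D => D ⊓ LinearMap.ker d) '' 𝒮) (hne.image _) (by
      rintro _ ⟨a, ha, rfl⟩ _ ⟨b, hb, rfl⟩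
      obtain ⟨c, hc, h₁, h₂⟩ := hdir a ha b hb
      exact ⟨_, ⟨c, hc, rfl⟩, inf_le_inf_right _ h₁, inf_le_inf_right _ h₂⟩) (by
      rintro _ ⟨D, hD, rfl⟩
      obtain ⟨hD₁, hD₂⟩ := h D hD
      let e : (D ⊓ LinearMap.ker d : Submodule R M) ≃ₗ[R] LinearMap.ker (d.restrict hD₁) :=
        { toFun x := ⟨⟨x, x.2.1⟩, Subtype.ext x.2.2⟩
          invFun x := ⟨x, x.1.2, congrArg Subtype.val x.2⟩
          map_add' _ _ := rfl
          map_smul' _ _ := rfl }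
      exact hD₂.isGorensteinInjective.of_iso e.toModuleIso)
    have hmem' : ∀ x, x ∈ (sSup ((fun D => D ⊓ LinearMap.ker d) '' 𝒮) : Submodule R M) ↔
        x ∈ (sSup 𝒮 : Submodule R M) ∧ d x = 0 := by
      intro x
      constructor
      · intro hx
        have : (sSup ((fun D => D ⊓ LinearMap.ker d) '' 𝒮) : Submodule R M) ≤
            sSup 𝒮 ⊓ LinearMap.ker d := by
          refine sSup_le ?_
          rintro _ ⟨D, hD, rfl⟩
          exact inf_le_inf_right _ (le_sSup hD)
        exact this hx
      · rintro ⟨hx, hdx⟩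
        obtain ⟨D, hD, hxD⟩ := (hmem x).1 hx
        have hle : D ⊓ LinearMap.ker d ≤ sSup ((fun D => D ⊓ LinearMap.ker d) '' 𝒮) :=
          le_sSup ⟨D, hD, rfl⟩
        exact hle ⟨hxD, hdx⟩
    let e : LinearMap.ker (d.restrict hst) ≃ₗ[R]
        (sSup ((fun D => D ⊓ LinearMap.ker d) '' 𝒮) : Submodule R M) :=
      { toFun x := ⟨x, (hmem' x).2 ⟨x.1.2, congrArg Subtype.val x.2⟩⟩
        invFun x := ⟨⟨x, ((hmem' x).1 x.2).1⟩, Subtype.ext ((hmem' x).1 x.2).2⟩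
        map_add' _ _ := rfl
        map_smul' _ _ := rfl }
    exact hs.of_iso e.toModuleIso

end Unions

section Quotients

variable {R : Type u} [Ring R] {A M C : Type u} [AddCommGroup A] [Module R A]
  [AddCommGroup M] [Module R M] [AddCommGroup C] [Module R C]
  {dA : A →ₗ[R] A} {d : M →ₗ[R] M} {dC : C →ₗ[R] C}

namespace TotallyAcyclicOn

theorem bot (d : M →ₗ[R] M) : TotallyAcyclicOn d ⊥ := by
  refine ⟨fun x hx => by rw [(Submodule.mem_bot R).1 hx, map_zero]; exact zero_mem _, fun I g =>
    ⟨0, fun x hx => Subsingleton.elim _ _⟩, fun x => ⟨fun _ => ⟨0, Subsingleton.elim _ _⟩,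
      fun _ => Subsingleton.elim _ _⟩, fun I _ _ _ f _ => ⟨0, fun x => Subsingleton.elim _ _⟩⟩

theorem totallyAcyclic (h : TotallyAcyclicOn d ⊤) : TotallyAcyclic d :=
  h.2.of_equiv Submodule.topEquiv fun _ => rfl

theorem range_of_injective {i : A →ₗ[R] M} (hi : Function.Injective i)
    (hdi : ∀ x, d (i x) = i (dA x)) (hA : TotallyAcyclic dA) :
    TotallyAcyclicOn d (LinearMap.range i) := by
  refine ⟨?_, hA.of_equiv (LinearEquiv.ofInjective i hi) fun x => Subtype.ext (hdi x)⟩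
  rintro _ ⟨x, rfl⟩
  exact ⟨dA x, (hdi x).symm⟩

theorem range {f : A →ₗ[R] M} (hdf : ∀ x, d (f x) = f (dA x)) (hA : TotallyAcyclic dA)
    (hf : TotallyAcyclicOn dA (LinearMap.ker f)) : TotallyAcyclicOn d (LinearMap.range f) := by
  refine ⟨?_, .of_exact_right (i := (LinearMap.ker f).subtype) (p := f.rangeRestrict)
    Subtype.val_injective f.surjective_rangeRestrict (fun x => ?_) (fun _ => rfl)
    (fun x => Subtype.ext (hdf x)) hf.2 hA⟩
  · rintro _ ⟨x, rfl⟩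
    exact ⟨dA x, (hdf x).symm⟩
  · refine ⟨fun hx => ⟨⟨x, congrArg Subtype.val hx⟩, rfl⟩, ?_⟩
    rintro ⟨y, rfl⟩
    exact Subtype.ext y.2

theorem comap {p : M →ₗ[R] C} (hp : Function.Surjective p) (hdp : ∀ x, dC (p x) = p (d x))
    (hd : ∀ x, d (d x) = 0) (hk : TotallyAcyclicOn d (LinearMap.ker p)) {L : Submodule R C}
    (hL : TotallyAcyclicOn dC L) : TotallyAcyclicOn d (L.comap p) := by
  have hs : ∀ x ∈ L.comap p, d x ∈ L.comap p := fun x hx => by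
    rw [Submodule.mem_comap, ← hdp]
    exact hL.1 _ hx
  refine ⟨hs, .of_exact (i := Submodule.inclusion (p := LinearMap.ker p) fun x hx => ?_)
    (p := p.restrict fun x hx => hx) (Submodule.inclusion_injective _) ?_ (fun x => ?_)
    (fun _ => rfl) (fun x => Subtype.ext (hdp x)) (fun x => Subtype.ext (hd x)) hk.2 hL.2⟩
  · rw [Submodule.mem_comap, LinearMap.mem_ker.1 hx]
    exact zero_mem _
  · rintro ⟨y, hy⟩
    obtain ⟨x, rfl⟩ := hp y
    exact ⟨⟨x, hy⟩, rfl⟩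
  · refine ⟨fun hx => ⟨⟨x, congrArg Subtype.val hx⟩, rfl⟩, ?_⟩
    rintro ⟨y, rfl⟩
    exact Subtype.ext y.2

theorem quotient (hd : TotallyAcyclic d) {D : Submodule R M} (hD : TotallyAcyclicOn d D) :
    TotallyAcyclic (D.mapQ D d hD.1) :=
  .of_exact_right (i := D.subtype) (p := D.mkQ) Subtype.val_injective D.mkQ_surjective
    (LinearMap.exact_subtype_mkQ D) (fun _ => rfl) (fun _ => rfl) hD.2 hd

end TotallyAcyclicOn

theorem GorensteinInjectiveClosed.totallyAcyclic_mapRange [IsNoetherianRing R]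
    (hR : GorensteinInjectiveClosed R) {ι : Type u} {N : ι → Type u} [∀ i, AddCommGroup (N i)]
    [∀ i, Module R (N i)] {d : ∀ i, N i →ₗ[R] N i} (hd : ∀ i, TotallyAcyclic (d i)) :
    TotallyAcyclic (DFinsupp.mapRange.linearMap d) := by
  classical
  have hlmk : ∀ (s : Finset ι) (v : ∀ i : (s : Set ι), N i) i, DFinsupp.lmk (R := R) (M := N) s v i =
      if h : i ∈ s then v ⟨i, h⟩ else 0 := fun _ _ _ => rfl
  have hmk : ∀ (s : Finset ι) (x : Π₀ i, N i),
      x ∈ LinearMap.range (DFinsupp.lmk (R := R) (M := N) s) ↔ ∀ i, i ∉ s → x i = 0 := by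
    refine fun s x => ⟨?_, fun h => ⟨fun i => x i, DFinsupp.ext fun i => ?_⟩⟩
    · rintro ⟨v, rfl⟩ i hi
      rw [hlmk, dif_neg hi]
    · by_cases hi : i ∈ s
      · rw [hlmk, dif_pos hi]
      · rw [hlmk, dif_neg hi, h i hi]
  have h := hR.totallyAcyclicOn_sSup (d := DFinsupp.mapRange.linearMap d)
    (𝒮 := Set.range fun s : Finset ι => LinearMap.range (DFinsupp.lmk (R := R) (M := N) s))
    (Set.range_nonempty _) (by
      rintro _ ⟨s, rfl⟩ _ ⟨t, rfl⟩
      refine ⟨_, ⟨s ∪ t, rfl⟩, fun x hx => ?_, fun x hx => ?_⟩ <;>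
      · rw [hmk] at hx ⊢
        exact fun i hi => hx i fun h => hi (by simp [h])) (by
      rintro _ ⟨s, rfl⟩
      refine .range_of_injective (DFinsupp.mk_injective s) (fun x => ?_)
        (TotallyAcyclic.pi fun i : (s : Set ι) => hd i)
      ext i
      change d i (DFinsupp.lmk (R := R) s x i) = _
      by_cases hi : i ∈ s
      · rw [hlmk, dif_pos hi, hlmk, dif_pos hi]
        rfl
      · rw [hlmk, dif_neg hi, hlmk, dif_neg hi, map_zero])
  have htop : sSup (Set.range fun s : Finset ι =>
      LinearMap.range (DFinsupp.lmk (R := R) (M := N) s)) = ⊤ := by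
    refine eq_top_iff.2 fun x _ => ?_
    have hle : LinearMap.range (DFinsupp.lmk (R := R) (M := N) x.support) ≤
        sSup (Set.range fun s : Finset ι => LinearMap.range (DFinsupp.lmk (R := R) (M := N) s)) :=
      le_sSup ⟨x.support, rfl⟩
    exact hle ((hmk _ _).2 fun i hi => by simpa using hi)
  rw [htop] at h
  exact h.totallyAcyclic

end Quotients

section SmallQuotients

variable {R : Type u} [Ring R]

variable (R) in
/-- Parametrizations, up to isomorphism, of small totally acyclic submodules equipped with a map
to `X`, together with a set of marked parameters and a distinguished parameter. -/
abbrev ReplaceOp (E X : Type u) : Type u :=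
  Submodule R (ClosureIndex (AcyclicOp.Arity R E) →₀ R) ×
    Set (ClosureIndex (AcyclicOp.Arity R E) × ClosureIndex (AcyclicOp.Arity R E)) ×
    (ClosureIndex (AcyclicOp.Arity R E) → X) × Set (ClosureIndex (AcyclicOp.Arity R E)) ×
    ClosureIndex (AcyclicOp.Arity R E)

variable (R) in
/-- A type which surjects onto every totally acyclic module over `X` without nonzero totally
acyclic submodules mapping to zero. -/
abbrev SmallIndex (E X : Type u) : Type u :=
  ClosureIndex fun _ : ReplaceOp R E X => ClosureIndex (AcyclicOp.Arity R E)

variable {E X M : Type u} [AddCommGroup E] [Module R E] [AddCommGroup X] [Module R X]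
  [AddCommGroup M] [Module R M]

/-- The parametrization `e` of a closed subset of `M` has the prescribed isomorphism type. -/
structure IsReplacement (d : M →ₗ[R] M) (Φ : M →ₗ[R] X) (o : ReplaceOp R E X)
    (v e : ClosureIndex (AcyclicOp.Arity R E) → M) : Prop where
  closed : IsClosedUnder (AcyclicOp.act (E := E) d) (Set.range e)
  ker : LinearMap.ker (Finsupp.linearCombination R e) = o.1
  diff : ∀ k l, (k, l) ∈ o.2.1 ↔ d (e k) = e l
  map : ∀ k, Φ (e k) = o.2.2.1 k
  marked : ∀ k ∈ o.2.2.2.1, e k = v k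

open Classical in
/-- The operation choosing a replacement. -/
noncomputable def ReplaceOp.act (d : M →ₗ[R] M) (Φ : M →ₗ[R] X) (o : ReplaceOp R E X)
    (v : ClosureIndex (AcyclicOp.Arity R E) → M) : M :=
  if h : ∃ e, IsReplacement d Φ o v e then h.choose o.2.2.2.2 else 0

theorem IsReplacement.exists_act {d : M →ₗ[R] M} {Φ : M →ₗ[R] X}
    {N : Submodule R (ClosureIndex (AcyclicOp.Arity R E) →₀ R)}
    {δ : Set (ClosureIndex (AcyclicOp.Arity R E) × ClosureIndex (AcyclicOp.Arity R E))}
    {χ : ClosureIndex (AcyclicOp.Arity R E) → X} {P : Set (ClosureIndex (AcyclicOp.Arity R E))}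
    {v e : ClosureIndex (AcyclicOp.Arity R E) → M}
    (h : ∀ k, IsReplacement d Φ (N, δ, χ, P, k) v e) :
    ∃ e', (∀ k, IsReplacement d Φ (N, δ, χ, P, k) v e') ∧
      ∀ k, ReplaceOp.act d Φ (N, δ, χ, P, k) v = e' k := by
  have h' : ∃ e, ∀ k, IsReplacement d Φ (N, δ, χ, P, k) v e := ⟨e, h⟩
  by_cases hK : Nonempty (ClosureIndex (AcyclicOp.Arity R E))
  · obtain ⟨k₀⟩ := hK
    have h₀ : ∃ e, IsReplacement d Φ (N, δ, χ, P, k₀) v e := ⟨e, h k₀⟩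
    have hk : ∀ k, IsReplacement d Φ (N, δ, χ, P, k) v h₀.choose := fun k =>
      ⟨h₀.choose_spec.closed, h₀.choose_spec.ker, h₀.choose_spec.diff, h₀.choose_spec.map,
        h₀.choose_spec.marked⟩
    refine ⟨h₀.choose, hk, fun k => ?_⟩
    rw [ReplaceOp.act, dif_pos ⟨_, hk k⟩]
    have : ∀ p q : (ClosureIndex (AcyclicOp.Arity R E) → M) → Prop, p = q →
        ∀ (hp : ∃ e, p e) (hq : ∃ e, q e), hp.choose k = hq.choose k := by
      rintro p _ rfl _ _
      rfl
    refine this _ _ (funext fun e => propext ⟨fun h => ?_, fun h => ?_⟩) _ _ <;>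
    exact ⟨h.closed, h.ker, h.diff, h.map, h.marked⟩
  · exact ⟨e, h, fun k => (hK ⟨k⟩).elim⟩

theorem IsLiftTest.exists_surjective_smallIndex (hE : IsLiftTest R E) {d : M →ₗ[R] M}
    (hd : TotallyAcyclic d) (Φ : M →ₗ[R] X)
    (hirr : ∀ D : Submodule R M, TotallyAcyclicOn d D → D ≤ LinearMap.ker Φ → D = ⊥) :
    ∃ f : SmallIndex R E X → M, Function.Surjective f := by
  classical
  obtain ⟨f, hf, h0⟩ := exists_isClosedUnder_range
    (ReplaceOp.act d Φ : ∀ _ : ReplaceOp R E X, _) (0 : M)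
  refine ⟨f, fun x => ?_⟩
  by_contra hx
  change x ∉ Set.range f at hx
  obtain ⟨e, he, k₀, rfl⟩ := exists_isClosedUnder_range (AcyclicOp.act (R := R) (E := E) d) x
  let P : Set (ClosureIndex (AcyclicOp.Arity R E)) := {k | e k ∈ Set.range f}
  let v : ClosureIndex (AcyclicOp.Arity R E) → M := fun k => if k ∈ P then e k else 0
  have hv : ∀ k, v k ∈ Set.range f := fun k => by
    by_cases hk : k ∈ P
    · have h : v k = e k := if_pos hk
      rw [h]
      exact hk
    · have h : v k = 0 := if_neg hk
      rwa [h]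
  obtain ⟨e', he', hact⟩ := IsReplacement.exists_act (d := d) (Φ := Φ) (v := v) (e := e) (P := P)
    (N := LinearMap.ker (Finsupp.linearCombination R e)) (δ := {q | d (e q.1) = e q.2})
    (χ := fun k => Φ (e k)) fun k => ⟨he, rfl, fun _ _ => Iff.rfl, fun _ => rfl,
      fun k hk => (if_pos hk).symm⟩
  have hB : ∀ k, e' k ∈ Set.range f := fun k => by
    rw [← hact]
    exact hf _ v hv
  obtain ⟨closed, ker, diff, map, marked⟩ := he' k₀
  obtain ⟨D, hDe, hDs, hD⟩ := he.exists_totallyAcyclicOn hE hd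
  obtain ⟨D₀, hD₀e, hD₀s, hD₀⟩ := (he.inter closed).exists_totallyAcyclicOn hE hd
  have hmem : ∀ y, y ∈ D ↔ ∃ k, e k = y := fun y => by rw [← SetLike.mem_coe, hDe]; rfl
  have hmem₀ : ∀ y, y ∈ D₀ ↔ y ∈ D ∧ ∃ k, e' k = y := fun y => by
    rw [← SetLike.mem_coe, hD₀e, ← SetLike.mem_coe, hDe]; rfl
  have hle : D₀ ≤ D := fun y hy => ((hmem₀ y).1 hy).1
  let p : (ClosureIndex (AcyclicOp.Arity R E) →₀ R) →ₗ[R] D :=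
    Finsupp.linearCombination R fun k => (⟨e k, (hmem _).2 ⟨k, rfl⟩⟩ : D)
  have hpe : ∀ z, (p z : M) = Finsupp.linearCombination R e z := fun z =>
    Finsupp.apply_linearCombination R D.subtype _ z
  have hps : ∀ y : D, ∃ k, e k = y ∧ p (Finsupp.single k 1) = y := fun y => by
    obtain ⟨k, hk⟩ := (hmem y).1 y.2
    exact ⟨k, hk, Subtype.ext (by rw [hpe]; simpa using hk)⟩
  obtain ⟨θ, hθ⟩ := LinearMap.exists_comp_eq_of_ker_le (p := p)
    (fun y => let ⟨k, _, hk⟩ := hps y; ⟨_, hk⟩) (q := Finsupp.linearCombination R e') fun z hz => by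
      have : z ∈ LinearMap.ker (Finsupp.linearCombination R e') := by
        rw [ker, LinearMap.mem_ker, ← hpe, hz]; rfl
      exact this
  have hθe : ∀ k (y : D), e k = y → θ y = e' k := fun k y hk => by
    have : p (Finsupp.single k 1) = y := Subtype.ext (by rw [hpe]; simpa using hk)
    rw [← this, hθ]
    simp
  let ψ : D →ₗ[R] M := D.subtype - θ
  have hψ : ∀ k (y : D), e k = y → ψ y = e k - e' k := fun k y hk => by
    rw [LinearMap.sub_apply, hθe k y hk, hk]; rfl
  have hψd : ∀ y, d (ψ y) = ψ (d.restrict hDs y) := fun y => by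
    obtain ⟨k, hk⟩ := (hmem y).1 y.2
    obtain ⟨l, hl⟩ := (hmem (d y)).1 (hDs y y.2)
    have h₁ : d (e k) = e l := by rw [hk, hl]
    rw [hψ k y hk, hψ l (d.restrict hDs y) hl, map_sub, h₁, (diff k l).1 h₁]
  have hker : LinearMap.ker ψ = LinearMap.range (Submodule.inclusion hle) := by
    ext y
    obtain ⟨k, hk⟩ := (hmem y).1 y.2
    rw [LinearMap.mem_ker, hψ k y hk, sub_eq_zero]
    constructor
    · intro h
      exact ⟨⟨y, (hmem₀ y).2 ⟨y.2, k, h.symm.trans hk⟩⟩, rfl⟩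
    · rintro ⟨z, rfl⟩
      obtain ⟨k', hk'⟩ := ((hmem₀ z).1 z.2).2
      have hkP : k ∈ P := by
        change e k ∈ Set.range f
        rw [hk]
        exact hk' ▸ hB k'
      exact ((marked k hkP).trans (if_pos hkP)).symm
  have hk : TotallyAcyclicOn (d.restrict hDs) (LinearMap.ker ψ) := by
    rw [hker]
    exact .range_of_injective (Submodule.inclusion_injective hle) (fun _ => rfl) hD₀
  have hL := hirr (LinearMap.range ψ) (.range hψd hD hk) (by
    rintro _ ⟨y, rfl⟩
    obtain ⟨k, hk⟩ := (hmem y).1 y.2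
    rw [LinearMap.mem_ker, hψ k y hk, map_sub, map, sub_self])
  have h₀ : ψ ⟨e k₀, (hmem _).2 ⟨k₀, rfl⟩⟩ = 0 := by
    have : ψ ⟨e k₀, (hmem _).2 ⟨k₀, rfl⟩⟩ ∈ LinearMap.range ψ := ⟨_, rfl⟩
    rwa [hL, Submodule.mem_bot] at this
  rw [hψ k₀ _ rfl, sub_eq_zero] at h₀
  exact hx (h₀ ▸ hB k₀)

theorem GorensteinInjectiveClosed.exists_small_quotient [IsNoetherianRing R]
    (hR : GorensteinInjectiveClosed R) (hE : IsLiftTest R E) {d : M →ₗ[R] M}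
    (hd : TotallyAcyclic d) (Φ : M →ₗ[R] X) :
    ∃ D : Submodule R M, TotallyAcyclicOn d D ∧ D ≤ LinearMap.ker Φ ∧
      ∃ f : SmallIndex R E X → M ⧸ D, Function.Surjective f := by
  obtain ⟨D, -, ⟨hD, hDΦ⟩, hmax⟩ := zorn_le_nonempty₀
    {D : Submodule R M | TotallyAcyclicOn d D ∧ D ≤ LinearMap.ker Φ} (fun c hc hchain y hy =>
      ⟨sSup c, ⟨hR.totallyAcyclicOn_sSup ⟨y, hy⟩ hchain.directedOn fun D hD => (hc hD).1,
        sSup_le fun D hD => (hc hD).2⟩, fun z hz => le_sSup hz⟩)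
    ⊥ ⟨.bot d, bot_le⟩
  refine ⟨D, hD, hDΦ, hE.exists_surjective_smallIndex (TotallyAcyclicOn.quotient hd hD) (D.liftQ Φ hDΦ)
    fun L hL hLΦ => ?_⟩
  have h := hmax ⟨.comap D.mkQ_surjective (fun _ => rfl) hd.d_d (by rwa [D.ker_mkQ]) hL,
    fun x hx => hLΦ hx⟩ (fun x hx => by
      rw [Submodule.mem_comap, Submodule.mkQ_apply, (Submodule.Quotient.mk_eq_zero D).2 hx]
      exact zero_mem _)
  rw [eq_bot_iff]
  intro y hy
  obtain ⟨x, rfl⟩ := D.mkQ_surjective y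
  exact (Submodule.Quotient.mk_eq_zero D).2 (h hy)

end SmallQuotients

section Precovers

variable {R : Type u} [Ring R] [IsNoetherianRing R] {E X : Type u} [AddCommGroup E] [Module R E]
  [AddCommGroup X] [Module R X]

variable (R) in
/-- The totally acyclic quotients of `ι →₀ R` equipped with a map to `X` that vanishes on
boundaries. -/
abbrev QuotientIndex (ι X : Type u) [AddCommGroup X] [Module R X] : Type u :=
  Σ S : Submodule R (ι →₀ R),
    {q : (((ι →₀ R) ⧸ S) →ₗ[R] ((ι →₀ R) ⧸ S)) × (((ι →₀ R) ⧸ S) →ₗ[R] X) //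
      TotallyAcyclic q.1 ∧ ∀ x, q.2 (q.1 x) = 0}

theorem GorensteinInjectiveClosed.exists_hom_quotientIndex (hR : GorensteinInjectiveClosed R)
    (hE : IsLiftTest R E) {M : Type u} [AddCommGroup M] [Module R M] {d : M →ₗ[R] M}
    (hd : TotallyAcyclic d) (Φ : M →ₗ[R] X) (hΦ : ∀ x, Φ (d x) = 0) :
    ∃ (a : QuotientIndex R (SmallIndex R E X) X) (h : M →ₗ[R] ((SmallIndex R E X →₀ R) ⧸ a.1)),
      ∀ x, h (d x) = a.2.1.1 (h x) ∧ a.2.1.2 (h x) = Φ x := by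
  obtain ⟨D, hD, hDΦ, f, hf⟩ := hR.exists_small_quotient hE hd Φ
  have hs : Function.Surjective (Finsupp.linearCombination R f) := fun y => by
    obtain ⟨k, rfl⟩ := hf y
    exact ⟨Finsupp.single k 1, by simp⟩
  let e := (Finsupp.linearCombination R f).quotKerEquivOfSurjective hs
  refine ⟨⟨LinearMap.ker (Finsupp.linearCombination R f),
    (e.symm.toLinearMap ∘ₗ D.mapQ D d hD.1 ∘ₗ e.toLinearMap, D.liftQ Φ hDΦ ∘ₗ e.toLinearMap),
    (TotallyAcyclicOn.quotient hd hD).of_equiv e.symm fun x => ?_, fun x => ?_⟩,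
    e.symm.toLinearMap ∘ₗ D.mkQ, fun x => ⟨?_, ?_⟩⟩
  · simp
  · obtain ⟨y, hy⟩ := D.mkQ_surjective (e x)
    simp [← hy, hΦ]
  · simp
  · simp

theorem GorensteinInjectiveClosed.exists_weakly_terminal (hR : GorensteinInjectiveClosed R)
    (X : Type u) [AddCommGroup X] [Module R X] :
    ∃ (N : Type u) (_ : AddCommGroup N) (_ : Module R N) (d' : N →ₗ[R] N) (Φ' : N →ₗ[R] X),
      TotallyAcyclic d' ∧ (∀ x, Φ' (d' x) = 0) ∧
      ∀ (M : Type u) [AddCommGroup M] [Module R M] (d : M →ₗ[R] M) (Φ : M →ₗ[R] X),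
        TotallyAcyclic d → (∀ x, Φ (d x) = 0) →
          ∃ h : M →ₗ[R] N, ∀ x, h (d x) = d' (h x) ∧ Φ' (h x) = Φ x := by
  classical
  obtain ⟨E, _, _, hE⟩ := exists_isLiftTest R
  have key : ∀ {ι : Type u} (N : ι → Type u) [∀ a, AddCommGroup (N a)] [∀ a, Module R (N a)]
      (d' : ∀ a, N a →ₗ[R] N a) (Φ' : ∀ a, N a →ₗ[R] X), (∀ a, TotallyAcyclic (d' a)) →
      (∀ a x, Φ' a (d' a x) = 0) →
      TotallyAcyclic (DFinsupp.mapRange.linearMap d') ∧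
      (∀ x, DFinsupp.lsum ℕ Φ' (DFinsupp.mapRange.linearMap d' x) = 0) ∧
      ∀ (M : Type u) [AddCommGroup M] [Module R M] (d : M →ₗ[R] M) (Φ : M →ₗ[R] X) (a : ι)
        (h : M →ₗ[R] N a), (∀ x, h (d x) = d' a (h x) ∧ Φ' a (h x) = Φ x) →
        ∃ h' : M →ₗ[R] Π₀ a, N a, ∀ x, h' (d x) = DFinsupp.mapRange.linearMap d' (h' x) ∧
          DFinsupp.lsum ℕ Φ' (h' x) = Φ x := by
    intro ι N _ _ d' Φ' hd' hΦ'
    refine ⟨hR.totallyAcyclic_mapRange hd', fun x => ?_, fun M _ _ d Φ a h ha =>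
      ⟨DFinsupp.lsingle a ∘ₗ h, fun x => ⟨?_, ?_⟩⟩⟩
    · rw [DFinsupp.sum_mapRange_index.linearMap]
      have : (fun a => (Φ' a).comp (d' a)) = 0 := funext fun a => LinearMap.ext (hΦ' a)
      rw [this, map_zero, LinearMap.zero_apply]
    · simp [(ha x).1]
    · simpa using (ha x).2
  obtain ⟨h₁, h₂, h₃⟩ := key
    (fun a : QuotientIndex R (SmallIndex R E X) X => (SmallIndex R E X →₀ R) ⧸ a.1)
    (fun a => a.2.1.1) (fun a => a.2.1.2) (fun a => a.2.2.1) (fun a => a.2.2.2)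
  refine ⟨_, _, _, _, _, h₁, h₂, fun M _ _ d Φ hd hΦ => ?_⟩
  obtain ⟨a, h, ha⟩ := hR.exists_hom_quotientIndex hE hd Φ hΦ
  exact h₃ M d Φ a h ha

theorem GorensteinInjectiveClosed.exists_isPrecover (hR : GorensteinInjectiveClosed R)
    (X : ModuleCat.{u} R) : ∃ (G : ModuleCat.{u} R) (φ : G ⟶ X),
      IsPrecover (fun N => IsGorensteinInjective N) φ := by
  obtain ⟨N, _, _, d', Φ', hd', hΦ', hN⟩ := hR.exists_weakly_terminal X
  have hs : ∀ {M : Type u} [AddCommGroup M] [Module R M] {d : M →ₗ[R] M} (hd : TotallyAcyclic d),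
      Function.Surjective (d.codRestrict (LinearMap.ker d) hd.d_d) := fun hd y => by
    obtain ⟨x, hx⟩ := (hd.exact _).1 y.2
    exact ⟨x, Subtype.ext hx⟩
  obtain ⟨φ, hφ⟩ := LinearMap.exists_comp_eq_of_ker_le (hs hd') (q := Φ') fun x hx => by
    obtain ⟨y, rfl⟩ := (hd'.exact x).1 (congrArg Subtype.val hx)
    exact hΦ' y
  refine ⟨_, ModuleCat.ofHom φ, hd'.isGorensteinInjective, fun G hG ψ => ?_⟩
  obtain ⟨M, _, _, d, i, r, hd, hi, hr⟩ := hG.exists_totallyAcyclic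
  obtain ⟨h, hh⟩ := hN M d (ψ.hom ∘ₗ r ∘ₗ d.codRestrict (LinearMap.ker d) hd.d_d) hd fun x => by
    have : d.codRestrict (LinearMap.ker d) hd.d_d (d x) = 0 := Subtype.ext (hd.d_d x)
    simp [this]
  have hhi : ∀ g, d' (h (i g)) = 0 := fun g => by rw [← (hh _).1, hi, map_zero]
  refine ⟨ModuleCat.ofHom ((h ∘ₗ i).codRestrict (LinearMap.ker d') hhi), ?_⟩
  ext g
  obtain ⟨y, hy⟩ := (hd.exact _).1 (hi g)
  have h₁ : (h ∘ₗ i).codRestrict (LinearMap.ker d') hhi g =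
      d'.codRestrict (LinearMap.ker d') hd'.d_d (h y) :=
    Subtype.ext ((congrArg h hy).symm.trans (hh y).1)
  have h₂ : d.codRestrict (LinearMap.ker d) hd.d_d y = ⟨i g, hi g⟩ := Subtype.ext hy
  change φ ((h ∘ₗ i).codRestrict (LinearMap.ker d') hhi g) = ψ.hom g
  rw [h₁, hφ, (hh y).2]
  simp [h₂, hr]

end Precovers

section Rigid

variable {𝒟 : Type*} [Category.{u} 𝒟]

/-- Data and properties of a long transfinite iteration of `toSucc` starting from `w`. -/
theorem exists_transfinite_iteration
    (hcol : ∀ (J : Type u) [LinearOrder J] [Nonempty J], HasColimitsOfShape J 𝒟)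
    (κ : Cardinal.{u}) [Fact κ.IsRegular] (w : 𝒟) (succ : 𝒟 → 𝒟) (toSucc : ∀ X, X ⟶ succ X) :
    ∃ (J : Type u) (_ : LinearOrder J) (_ : SuccOrder J) (_ : NoMaxOrder J) (_ : WellFoundedLT J)
      (_ : OrderBot J) (F : J ⥤ 𝒟), Cardinal.mk J = κ ∧ IsCardinalFiltered J κ ∧
      F.IsWellOrderContinuous ∧ Nonempty (F.obj ⊥ ≅ w) ∧
      ∀ j, ∃ e : F.obj (Order.succ j) ≅ succ (F.obj j),
        F.map (homOfLE (Order.le_succ j)) = toSucc _ ≫ e.inv := by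
  have hκ : κ.IsRegular := Fact.out
  let J := κ.ord.ToType
  have : NoMaxOrder J := Cardinal.noMaxOrder hκ.aleph0_le
  have : Nonempty J := Cardinal.mk_ne_zero_iff.1 (by
    rw [Cardinal.mk_ord_toType]
    exact hκ.pos.ne')
  let _ : SuccOrder J := SuccOrder.ofLinearWellFoundedLT J
  let _ : OrderBot J := WellFoundedLT.toOrderBot J
  have : HasIterationOfShape J 𝒟 :=
    { hasColimitsOfShape_of_isSuccLimit j hj := by
        have : Nonempty (Set.Iio j) := hj.nonempty_Iio.to_subtype
        exact hcol _
      hasColimitsOfShape := hcol J }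
  let Φ : SmallObject.SuccStruct 𝒟 := { X₀ := w, succ := succ, toSucc := toSucc }
  exact ⟨J, _, _, inferInstance, inferInstance, inferInstance, Φ.iterationFunctor J,
    Cardinal.mk_ord_toType _, inferInstance, inferInstance, ⟨Φ.iterationFunctorObjBotIso J⟩,
    fun j => ⟨Φ.iterationFunctorObjSuccIso j (not_isMax j),
      Φ.iterationFunctor_map_succ j (not_isMax j)⟩⟩

/-- If every map out of `G` is injective and there is a map from each object to `G`, then every
endomorphism of `G` is surjective. -/
theorem surjective_of_injective_of_weaklyTerminal
    (hcol : ∀ (J : Type u) [LinearOrder J] [Nonempty J], HasColimitsOfShape J 𝒟)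
    (U : 𝒟 ⥤ Type u) {G : 𝒟}
    (hG : ∀ X : 𝒟, Nonempty (X ⟶ G))
    (hinj : ∀ (Y : 𝒟) (f : G ⟶ Y), Function.Injective (U.map f)) (f : G ⟶ G) :
    Function.Surjective (U.map f) := by
  by_contra hf
  let κ : Cardinal.{u} := Order.succ (max (Cardinal.mk (U.obj G)) Cardinal.aleph0)
  have : Fact κ.IsRegular := ⟨Cardinal.isRegular_succ (le_max_right _ _)⟩
  obtain ⟨J, _, _, _, _, _, F, hJ, -, -, -, hsucc⟩ := exists_transfinite_iteration hcol κ G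
    (fun _ => G) fun X => (hG X).some ≫ f
  choose e he using hsucc
  obtain ⟨q⟩ := hG (colimit F)
  let r : ∀ j, U.obj (F.obj j) → U.obj G := fun j => U.map (colimit.ι F j ≫ q)
  have hmono : ∀ {i j}, i ≤ j → Set.range (r i) ⊆ Set.range (r j) := by
    rintro i j h _ ⟨x, rfl⟩
    refine ⟨U.map (F.map (homOfLE h)) x, ?_⟩
    change U.map _ (U.map _ x) = U.map _ x
    rw [← Functor.map_comp_apply, colimit.w_assoc]
  have hlt : ∀ j, ∃ x, x ∈ Set.range (r (Order.succ (Order.succ j))) ∧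
      x ∉ Set.range (r (Order.succ j)) := fun j => by
    obtain ⟨y, hy⟩ := not_forall.1 hf
    refine ⟨r _ (U.map (e (Order.succ j)).inv y), ⟨_, rfl⟩, ?_⟩
    rintro ⟨x, hx⟩
    refine hy ⟨U.map (hG _).some x, ?_⟩
    have hri : Function.Injective (U.map ((e (Order.succ j)).inv ≫ colimit.ι F _ ≫ q)) := hinj _ _
    apply hri
    refine (U.map_comp_apply _ _ _).trans (Eq.trans ?_ (hx.trans (U.map_comp_apply _ _ y).symm))
    change _ = U.map _ x
    rw [← colimit.w F (homOfLE (Order.le_succ (Order.succ j))), he]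
    simp only [Functor.map_comp_apply]
  choose x hx hx' using hlt
  have hxi : Function.Injective x := by
    have : ∀ i j, i < j → x i ≠ x j := fun i j hij h =>
      hx' j (h ▸ hmono (Order.succ_le_succ (Order.succ_le_of_lt hij)) (hx i))
    intro i j h
    rcases lt_trichotomy i j with hij | hij | hij
    · exact (this i j hij h).elim
    · exact hij
    · exact (this j i hij h.symm).elim
  have h := Cardinal.mk_le_of_injective hxi
  rw [hJ] at h
  exact absurd ((Order.lt_succ _).trans_le h) (not_lt.2 (le_max_left _ _))

theorem exists_injective_of_weaklyTerminal
    (hcol : ∀ (J : Type u) [LinearOrder J] [Nonempty J], HasColimitsOfShape J 𝒟)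
    (U : 𝒟 ⥤ Type u)
    (hU : ∀ (J : Type u) [LinearOrder J] [Nonempty J], PreservesColimitsOfShape J U) {w : 𝒟}
    (hw : ∀ X : 𝒟, Nonempty (X ⟶ w)) :
    ∃ G : 𝒟, (∀ X : 𝒟, Nonempty (X ⟶ G)) ∧
      ∀ (Y : 𝒟) (f : G ⟶ Y), Function.Injective (U.map f) := by
  by_contra! hno
  have ht : ∀ X : 𝒟, ∃ t : X ⟶ w, (∀ Y : 𝒟, Nonempty (Y ⟶ X)) → ¬ Function.Injective (U.map t) := by
    intro X
    by_cases hX : ∀ Y : 𝒟, Nonempty (Y ⟶ X)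
    · obtain ⟨Y, f, hf⟩ := hno X hX
      obtain ⟨g⟩ := hw Y
      refine ⟨f ≫ g, fun _ h => hf ?_⟩
      rw [U.map_comp] at h
      exact Function.Injective.of_comp h
    · exact ⟨(hw X).some, fun h => (hX h).elim⟩
  choose t ht using ht
  let κ : Cardinal.{u} := Order.succ (max (Cardinal.mk (U.obj w × U.obj w)) Cardinal.aleph0)
  have : Fact κ.IsRegular := ⟨Cardinal.isRegular_succ (le_max_right _ _)⟩
  obtain ⟨J, _, _, _, _, _, F, -, _, _, ⟨e₀⟩, hsucc⟩ :=
    exists_transfinite_iteration hcol κ w (fun _ => w) t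
  have hub : ∀ {ι : Type u} (s : ι → J), Cardinal.mk ι < κ → ∃ j, ∀ i, s i ≤ j := fun s hs =>
    ⟨IsCardinalFiltered.max (κ := κ) s (hasCardinalLT_iff_cardinal_mk_lt _ _ |>.2 hs),
      fun i => leOfHom (IsCardinalFiltered.toMax s _ i)⟩
  have hFw : ∀ j (Y : 𝒟), Nonempty (Y ⟶ F.obj j) := fun j Y =>
    ⟨(hw Y).some ≫ e₀.inv ≫ F.map (homOfLE bot_le)⟩
  have hni : ∀ j, ¬ Function.Injective (U.map (F.map (homOfLE (Order.le_succ j)))) := by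
    intro j h
    obtain ⟨e, he⟩ := hsucc j
    rw [he, U.map_comp] at h
    exact ht _ (hFw j) (Function.Injective.of_comp h)
  let m : ∀ {i j}, i ≤ j → U.obj (F.obj i) → U.obj (F.obj j) := fun h => U.map (F.map (homOfLE h))
  have hm : ∀ {i j k} (h : i ≤ j) (h' : j ≤ k) x, m h' (m h x) = m (h.trans h') x :=
    fun h h' x => by
      change U.map _ (U.map _ x) = U.map _ x
      rw [← Functor.map_comp_apply, ← F.map_comp]
      rfl
  have hstab : ∀ i, ∃ k, ∃ hk : Order.succ i ≤ k, ∀ x y j (hj : Order.succ i ≤ j),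
      m hj x = m hj y → m hk x = m hk y := by
    intro i
    obtain ⟨e, -⟩ := hsucc i
    have hc : Cardinal.mk (U.obj (F.obj (Order.succ i)) × U.obj (F.obj (Order.succ i))) < κ := by
      have e' : U.obj (F.obj (Order.succ i)) ≃ U.obj w := (U.mapIso e).toEquiv
      rw [Cardinal.mk_congr (e'.prodCongr e')]
      exact Order.lt_succ_of_le (le_max_left _ _)
    classical
    obtain ⟨k, hk⟩ := hub (fun p : U.obj (F.obj (Order.succ i)) × U.obj (F.obj (Order.succ i)) =>
      if h : ∃ j, ∃ hj : Order.succ i ≤ j, m hj p.1 = m hj p.2 then h.choose else i) hc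
    refine ⟨max k (Order.succ i), le_max_right _ _, fun x y j hj hxy => ?_⟩
    have h : ∃ j, ∃ hj : Order.succ i ≤ j, m hj x = m hj y := ⟨j, hj, hxy⟩
    have hle := hk (x, y)
    rw [dif_pos h] at hle
    obtain ⟨h₁, h₂⟩ := h.choose_spec
    rw [← hm h₁ (hle.trans (le_max_left _ _)), h₂, hm]
  choose s hs hstab using hstab
  let a : ℕ → J := fun n => s^[n] ⊥
  have has : ∀ n, Order.succ (a n) ≤ a (n + 1) := fun n => by
    simp only [a, Function.iterate_succ_apply']
    exact hs _
  have halt : ∀ n, a n < a (n + 1) := fun n => (Order.lt_succ _).trans_le (has n)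
  have hamono : StrictMono a := strictMono_nat_of_lt_succ halt
  obtain ⟨b, hb⟩ := hub (fun n : ULift.{u} ℕ => a n.down)
    ((Cardinal.mk_le_aleph0).trans_lt (Order.lt_succ_of_le (le_max_right _ _)))
  obtain ⟨c, hc⟩ : ∃ c, IsLeast {c | ∀ n, a n ≤ c} c :=
    WellFounded.has_min wellFounded_lt {c | ∀ n, a n ≤ c} ⟨b, fun n => hb ⟨n⟩⟩ |>.imp
      fun _ h => ⟨h.1, fun y hy => not_lt.1 (h.2 y hy)⟩
  have hlt : ∀ i, i < c → ∃ n, i < a n := fun i hi => by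
    by_contra! h
    exact absurd (hc.2 h) (not_le.2 hi)
  have hac : ∀ n, Order.succ (a n) ≤ c := fun n => (has n).trans (hc.1 _)
  have hlim : Order.IsSuccLimit c := by
    refine ⟨fun h => ((halt 0).trans_le (hc.1 1)).not_isMin h,
      Order.isSuccPrelimit_of_succ_lt fun i hi => ?_⟩
    obtain ⟨n, hn⟩ := hlt i hi
    exact (Order.succ_le_of_lt hn).trans_lt ((halt n).trans_le (hc.1 _))
  have hsurj : ∀ z, ∃ n x, m (hac n) x = z := by
    intro z
    have : Nonempty (Set.Iio c) := hlim.nonempty_Iio.to_subtype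
    obtain ⟨⟨i, hi⟩, x, hx⟩ := Types.jointly_surjective_of_isColimit
      (isColimitOfPreserves U (F.isColimitOfIsWellOrderContinuous c hlim)) z
    obtain ⟨n, hn⟩ := hlt i hi
    refine ⟨n, m (hn.le.trans (Order.le_succ _)) x, ?_⟩
    exact (hm _ _ _).trans hx
  refine hni c fun z₁ z₂ h => ?_
  obtain ⟨n₁, x₁, rfl⟩ := hsurj z₁
  obtain ⟨n₂, x₂, rfl⟩ := hsurj z₂
  have hle : ∀ {k l}, k ≤ l → Order.succ (a k) ≤ Order.succ (a l) := fun h =>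
    Order.succ_le_succ (hamono.monotone h)
  rw [← hm (hle (le_max_left n₁ n₂)) (hac _), ← hm (hle (le_max_right n₁ n₂)) (hac _)] at h ⊢
  have h' := hstab _ _ _ _ ((hac _).trans (Order.le_succ c)) 
    ((hm (hac _) (Order.le_succ c) _).symm.trans (h.trans (hm (hac _) (Order.le_succ c) _)))
  have hsc : s (a (max n₁ n₂)) ≤ c := by
    have := hc.1 (max n₁ n₂ + 1)
    simp only [a, Function.iterate_succ_apply'] at this
    exact this
  rw [← hm (hs _) hsc, h', hm]

/-- A category with directed colimits and a weakly terminal object has a weakly terminal object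
all of whose endomorphisms are bijective. -/
theorem exists_bijective_of_weaklyTerminal
    (hcol : ∀ (J : Type u) [LinearOrder J] [Nonempty J], HasColimitsOfShape J 𝒟)
    (U : 𝒟 ⥤ Type u)
    (hU : ∀ (J : Type u) [LinearOrder J] [Nonempty J], PreservesColimitsOfShape J U) {w : 𝒟}
    (hw : ∀ X : 𝒟, Nonempty (X ⟶ w)) :
    ∃ G : 𝒟, (∀ X : 𝒟, Nonempty (X ⟶ G)) ∧ ∀ f : G ⟶ G, Function.Bijective (U.map f) := by
  obtain ⟨G, hG, hinj⟩ := exists_injective_of_weaklyTerminal hcol U hU hw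
  exact ⟨G, hG, fun f => ⟨hinj G f, surjective_of_injective_of_weaklyTerminal hcol U hG hinj f⟩⟩

end Rigid

section Covers

variable {R : Type u} [Ring R]

theorem GorensteinInjectiveClosed.exists_isCover_of_isPrecover (hR : GorensteinInjectiveClosed R)
    {X W : ModuleCat.{u} R} {φ : W ⟶ X} (hφ : IsPrecover (fun N => IsGorensteinInjective N) φ) :
    ∃ (G : ModuleCat.{u} R) (γ : G ⟶ X), IsCover (fun N => IsGorensteinInjective N) γ := by
  let P : ObjectProperty (ModuleCat.{u} R) := fun N => IsGorensteinInjective N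
  let Q : ObjectProperty (Over X) := P.inverseImage (Over.forget X)
  have hP : ∀ (J : Type u) [LinearOrder J] [Nonempty J], P.IsClosedUnderColimitsOfShape J :=
    fun J _ _ => ⟨fun Y ⟨h⟩ =>
      (hR J h.diag h.prop_diag_obj).of_iso
        (h.isColimit.coconePointUniqueUpToIso (colimit.isColimit h.diag))⟩
  have hQ : ∀ (J : Type u) [LinearOrder J] [Nonempty J], Q.IsClosedUnderColimitsOfShape J :=
    fun J _ _ => by
      have := hP J
      infer_instance
  obtain ⟨G, hG, hbij⟩ := exists_bijective_of_weaklyTerminal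
    (𝒟 := Q.FullSubcategory) (fun J _ _ => by have := hQ J; infer_instance)
    (Q.ι ⋙ Over.forget X ⋙ forget (ModuleCat.{u} R))
    (fun J _ _ => by have := hQ J; infer_instance) (w := ⟨Over.mk φ, hφ.1⟩) fun Y => by
      obtain ⟨h, hh⟩ := hφ.2 Y.obj.left Y.property Y.obj.hom
      exact ⟨Q.homMk (Over.homMk h hh)⟩
  refine ⟨G.obj.left, G.obj.hom, ⟨G.property, fun G' hG' ψ => ?_⟩, fun f hf => ?_⟩
  · obtain ⟨h⟩ := hG ⟨Over.mk ψ, hG'⟩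
    exact ⟨h.hom.left, Over.w h.hom⟩
  · have h := hbij (Q.homMk (Over.homMk f hf))
    have : IsIso ((forget (ModuleCat.{u} R)).map f) := (isIso_iff_bijective _).2 h
    exact isIso_of_reflects_iso f (forget (ModuleCat.{u} R))

end Covers

/-- Let `R` be a two-sided noetherian ring.  If the class of Gorenstein
injective left `R`-modules is closed under direct limits, then it is covering. -/
theorem gorensteinInjective_covering_of_closed_under_direct_limits
    (R : Type u) [Ring R] [IsNoetherianRing R] [IsNoetherianRing Rᵐᵒᵖ]
    (hlim : ∀ (ι : Type u) [Preorder ι] [IsDirected ι (· ≤ ·)] [Nonempty ι]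
      (F : ι ⥤ ModuleCat.{u} R), (∀ i, IsGorensteinInjective (F.obj i)) →
        IsGorensteinInjective (colimit F)) :
    ∀ X : ModuleCat.{u} R, ∃ (G : ModuleCat.{u} R) (φ : G ⟶ X),
      IsCover (fun N => IsGorensteinInjective N) φ := by
  intro X
  have hR : GorensteinInjectiveClosed R := hlim
  obtain ⟨W, φ, hφ⟩ := hR.exists_isPrecover X
  exact hR.exists_isCover_of_isPrecover hφ
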